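/- arXiv:2007.05901 — 2 statements merged into one kernel-verified Lean document; each statement's English description precedes it below -/
import Mathlib

section
/- Let m ≥ 3, let R(m−2,m) = R(1,m)^⊥, and let t_1, t_2, t_3 be three pairwise distinct coordinate positions. Then: (1) (R(m−2,m)_{{t_1,t_2,t_3}})^⊥ is a [2^m−3, m+1, 2^{m−1}−3] binary code with weight enumerator 1 + (2^{m−2}−1)z^{2^{m−1}−3} + 3·2^{m−2} z^{2^{m−1}−2} + 3·2^{m−2} z^{2^{m−1}−1} + (2^{m−2}−1)z^{2^{m−1}} + z^{2^m−3}; and (2) R(m−2,m)_{{t_1,t_2,t_3}} is a [2^m−3, 2^m−m−4, 4] binary code. -/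
open Finset

section Defs

variable {F : Type} [Field F]

/-- The dual of a linear code `C ⊆ F^ι` w.r.t. the standard inner product. -/
def dualCode {ι : Type} [Fintype ι] (C : Submodule F (ι → F)) :
    Submodule F (ι → F) where
  carrier := {x | ∀ c ∈ C, ∑ i, x i * c i = 0}
  add_mem' := by
    intro a b ha hb c hc
    simp only [Set.mem_setOf_eq] at ha hb ⊢
    simp only [Pi.add_apply, add_mul, Finset.sum_add_distrib, ha c hc, hb c hc, add_zero]
  zero_mem' := by
    intro c hc
    simp
  smul_mem' := by
    intro r a ha c hc
    simp only [Set.mem_setOf_eq] at ha ⊢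
    simp only [Pi.smul_apply, smul_eq_mul, mul_assoc, ← Finset.mul_sum, ha c hc, mul_zero]

/-- The subcode of codewords vanishing on every coordinate in `T`. -/
def zeroOn {ι : Type} (T : Finset ι) : Submodule F (ι → F) where
  carrier := {x | ∀ i ∈ T, x i = 0}
  add_mem' := by
    intro a b ha hb i hi
    simp only [Set.mem_setOf_eq] at ha hb
    simp [Pi.add_apply, ha i hi, hb i hi]
  zero_mem' := by intro i _; simp
  smul_mem' := by
    intro r a ha i hi
    simp only [Set.mem_setOf_eq] at ha
    simp [Pi.smul_apply, ha i hi]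

/-- Deleting the coordinates in `T`. -/
def restrictTo {ι : Type} (T : Finset ι) : (ι → F) →ₗ[F] ({i : ι // i ∉ T} → F) :=
  LinearMap.funLeft F F Subtype.val

/-- The punctured code `C^T`: delete the coordinates in `T` from every codeword. -/
def puncturedCode {ι : Type} (C : Submodule F (ι → F)) (T : Finset ι) :
    Submodule F ({i : ι // i ∉ T} → F) :=
  C.map (restrictTo T)

/-- The shortened code `C_T`: take the codewords vanishing on `T`, then delete `T`. -/
def shortenedCode {ι : Type} (C : Submodule F (ι → F)) (T : Finset ι) :
    Submodule F ({i : ι // i ∉ T} → F) :=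
  (C ⊓ zeroOn T).map (restrictTo T)

/-- The code `C` has minimum distance (exactly) `d`. -/
def IsMinDist {ι : Type} [Fintype ι] [DecidableEq F] (C : Submodule F (ι → F)) (d : ℕ) : Prop :=
  (∃ c ∈ C, c ≠ 0 ∧ hammingNorm c = d) ∧ ∀ c ∈ C, c ≠ 0 → d ≤ hammingNorm c

/-- `A_k(C)`: the number of codewords of Hamming weight `k` in `C`. -/
noncomputable def weightCount {ι : Type} [Fintype ι] [DecidableEq F]
    (C : Submodule F (ι → F)) (k : ℕ) : ℕ :=
  Nat.card {c : ι → F // c ∈ C ∧ hammingNorm c = k}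

/-- A monomial transformation: permute the coordinates and scale each coordinate. -/
def monomialMap {ι κ : Type} (σ : ι ≃ κ) (u : κ → F) : (ι → F) →ₗ[F] (κ → F) where
  toFun x := fun j => u j * x (σ.symm j)
  map_add' a b := by
    funext j
    simp [Pi.add_apply, mul_add]
  map_smul' r a := by
    funext j
    simp only [Pi.smul_apply, smul_eq_mul, RingHom.id_apply]
    ring

/-- Monomial equivalence of linear codes. -/
def MonomiallyEquiv {ι κ : Type} (C : Submodule F (ι → F)) (D : Submodule F (κ → F)) : Prop :=
  ∃ (σ : ι ≃ κ) (u : κ → F), (∀ j, u j ≠ 0) ∧ D = C.map (monomialMap σ u)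

/-- The syndrome map attached to a parity-check matrix with columns `v i`. -/
def checkMap {m n : ℕ} (v : Fin n → (Fin m → F)) : (Fin n → F) →ₗ[F] (Fin m → F) where
  toFun x := fun j => ∑ i, x i * v i j
  map_add' a b := by
    funext j
    simp [Pi.add_apply, add_mul, Finset.sum_add_distrib]
  map_smul' r a := by
    funext j
    simp [Pi.smul_apply, Finset.mul_sum, mul_assoc]

/-- `v` lists exactly one nonzero vector from each one-dimensional subspace of `F^m`. -/
def IsHammingMatrix {m n : ℕ} (v : Fin n → (Fin m → F)) : Prop :=
  (∀ i, v i ≠ 0) ∧ ∀ w : Fin m → F, w ≠ 0 → ∃! i : Fin n, ∃ c : F, w = c • v i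

/-- The Hamming code attached to a parity-check matrix whose columns are the `v i`. -/
def hammingCode {m n : ℕ} (v : Fin n → (Fin m → F)) : Submodule F (Fin n → F) :=
  LinearMap.ker (checkMap v)

/-- The Simplex code: the dual of the Hamming code. -/
def simplexCode {m n : ℕ} (v : Fin n → (Fin m → F)) : Submodule F (Fin n → F) :=
  dualCode (hammingCode v)

end Defs

/-- The first-order Reed-Muller code `R(1,m)`: the span of the constant function `1`
and the coordinate functions on `GF(2)^m`; equivalently, all functions
`x ↦ a₀ + u ⬝ x` with `a₀ ∈ GF(2)`, `u ∈ GF(2)^m`. -/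
def RM1 (m : ℕ) : Submodule (ZMod 2) ((Fin m → ZMod 2) → ZMod 2) :=
  Submodule.span (ZMod 2)
    ({fun _ => 1} ∪ Set.range (fun i : Fin m => fun x : Fin m → ZMod 2 => x i))

/-- The Reed-Muller code `R(m-2, m)`, defined as the dual of `R(1,m)`. -/
def RMm2 (m : ℕ) : Submodule (ZMod 2) ((Fin m → ZMod 2) → ZMod 2) :=
  dualCode (RM1 m)


theorem aux_dual_eq {F ι : Type} [Field F] [Fintype ι] [DecidableEq ι] (C : Submodule F (ι → F)) :
    dualCode C = LinearMap.BilinForm.orthogonal (dotProductBilin F F : LinearMap.BilinForm F (ι → F)) C := by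
  ext x
  simp only [LinearMap.BilinForm.mem_orthogonal_iff]
  constructor
  · intro h c hc
    have := h c hc
    simpa [LinearMap.BilinForm.IsOrtho, LinearMap.IsOrtho, dotProduct, mul_comm] using this
  · intro h c hc
    have := h c hc
    simpa [LinearMap.BilinForm.IsOrtho, LinearMap.IsOrtho, dotProduct, mul_comm] using this

theorem aux_refl {F ι : Type} [Field F] [Fintype ι]  :
    (dotProductBilin F F : LinearMap.BilinForm F (ι → F)).IsRefl := by
  intro x y h
  simpa [dotProduct_comm] using h

theorem aux_nondeg {F ι : Type} [Field F] [Fintype ι] [DecidableEq ι] :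
    (dotProductBilin F F : LinearMap.BilinForm F (ι → F)).Nondegenerate := by
  constructor
  · intro x h
    ext i
    simpa using h (Pi.single i 1)
  · intro x h
    ext i
    simpa using h (Pi.single i 1)

theorem aux_dual_dual {F ι : Type} [Field F] [Fintype ι] [DecidableEq ι] (C : Submodule F (ι → F)) :
    dualCode (dualCode C) = C := by
  rw [aux_dual_eq, aux_dual_eq]
  exact LinearMap.BilinForm.orthogonal_orthogonal (B := (dotProductBilin F F : LinearMap.BilinForm F (ι → F))) aux_nondeg aux_refl C

theorem aux_finrank {F ι : Type} [Field F] [Fintype ι] [DecidableEq ι] (C : Submodule F (ι → F)) :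
    Module.finrank F (dualCode C) = Fintype.card ι - Module.finrank F C := by
  rw [aux_dual_eq, LinearMap.BilinForm.finrank_orthogonal aux_nondeg]
  simp

theorem aux_sum {F ι : Type} [Field F] [Fintype ι] [DecidableEq ι] (T : Finset ι) (f : ι → F)
    (h : ∀ i ∈ T, f i = 0) : ∑ i : {i // i ∉ T}, f i = ∑ i, f i := by
  rw [← Finset.sum_subset (Finset.subset_univ (univ.filter (· ∉ T))) (f := f)]
  · exact (Finset.sum_subtype _ (by simp) f).symm
  · intro x _ hx
    exact h x (by simpa using hx)

theorem aux_short {F ι : Type} [Field F] [Fintype ι] [DecidableEq ι] (C : Submodule F (ι → F))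
    (T : Finset ι) : dualCode (puncturedCode C T) = shortenedCode (dualCode C) T := by
  ext x
  constructor
  · intro h
    refine ⟨fun i => if hi : i ∉ T then x ⟨i, hi⟩ else 0, ⟨?_, ?_⟩, ?_⟩
    · intro c hc
      have := h _ ⟨c, hc, rfl⟩
      refine Eq.trans ?_ this
      rw [← aux_sum T]
      · refine Finset.sum_congr rfl fun i _ => ?_
        simp [restrictTo, LinearMap.funLeft, i.2]
      · intro i hi; simp [hi]
    · intro i hi
      simp [hi]
    · ext i
      simp [restrictTo, LinearMap.funLeft, i.2]
  · rintro ⟨y, ⟨hy, hy0⟩, rfl⟩ _ ⟨c, hc, rfl⟩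
    have := hy c hc
    refine Eq.trans ?_ this
    rw [← aux_sum T]
    · rfl
    · intro i hi; simp [hy0 i hi]

theorem aux_fiber {A B : Type} [AddGroup A] [AddGroup B] [Fintype A] [Fintype B] [DecidableEq B]
    (f : A →+ B) (hf : Function.Surjective f) (b : B) :
    (univ.filter (fun a => f a = b)).card * Fintype.card B = Fintype.card A := by
  have h := Finset.card_eq_sum_card_fiberwise (f := f) (s := univ) (t := univ) (by simp)
  rw [Finset.card_univ] at h
  rw [h, Finset.sum_congr rfl (fun x _ => AddMonoidHom.card_fiber_eq_of_mem_range f (hf x) (hf b))]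
  simp [mul_comm]

def phi (m : ℕ) : (ZMod 2 × (Fin m → ZMod 2)) →ₗ[ZMod 2] ((Fin m → ZMod 2) → ZMod 2) where
  toFun p := fun x => p.1 + ∑ i, p.2 i * x i
  map_add' p q := by
    ext x
    simp [add_mul, Finset.sum_add_distrib]; ring
  map_smul' r p := by
    ext x
    simp [mul_add, Finset.mul_sum, mul_assoc]

theorem phi_apply {m : ℕ} (p : ZMod 2 × (Fin m → ZMod 2)) (x) :
  phi m p x = p.1 + ∑ i, p.2 i * x i := rfl

theorem RM1_eq (m : ℕ) : RM1 m = LinearMap.range (phi m) := by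
  apply le_antisymm
  · rw [RM1, Submodule.span_le]
    rintro f (rfl | ⟨i, rfl⟩)
    · exact ⟨(1, 0), by ext x; simp [phi_apply]⟩
    · exact ⟨(0, Pi.single i 1), by ext x; simp [phi_apply, Pi.single_apply]⟩
  · rintro _ ⟨p, rfl⟩
    have : phi m p = p.1 • (fun _ => 1) + ∑ i, p.2 i • (fun x : Fin m → ZMod 2 => x i) := by
      ext x; simp [phi_apply]
    rw [this]
    refine add_mem (Submodule.smul_mem _ _ (Submodule.subset_span (Or.inl rfl))) (sum_mem fun i _ => Submodule.smul_mem _ _ (Submodule.subset_span (Or.inr ⟨i, rfl⟩)))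

theorem z2 (a : ZMod 2) : a = 0 ∨ a = 1 := by revert a; decide

theorem sep2 {m : ℕ} {s t : Fin m → ZMod 2} (h : s ≠ t) : ∃ p, phi m p s = 1 ∧ phi m p t = 0 := by
  obtain ⟨i, hi⟩ := Function.ne_iff.1 h
  refine ⟨(t i, Pi.single i 1), ?_⟩
  simp only [phi_apply, Pi.single_apply, ite_mul, one_mul, zero_mul, Finset.sum_ite_eq', Finset.mem_univ, if_true]
  generalize s i = a at *
  generalize t i = b at *
  revert a b; decide

theorem phi_one {m : ℕ} (x) : phi m (1, 0) x = 1 := by simp [phi_apply]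

theorem sep3 {m : ℕ} {r s t : Fin m → ZMod 2} (h : r ≠ s) (h' : r ≠ t) :
    ∃ p, phi m p r = 1 ∧ phi m p s = 0 ∧ phi m p t = 0 := by
  obtain ⟨p, hp, hp'⟩ := sep2 h
  obtain ⟨q, hq, hq'⟩ := sep2 h'
  rcases z2 (phi m p t) with h1 | h1
  · exact ⟨p, hp, hp', h1⟩
  rcases z2 (phi m q s) with h2 | h2
  · exact ⟨q, hq, h2, hq'⟩
  refine ⟨(1, 0) + p + q, ?_⟩
  simp only [map_add, Pi.add_apply, phi_one, *]
  decide

theorem wt_phi {m : ℕ} (a : ZMod 2) (u : Fin m → ZMod 2) (hu : u ≠ 0) :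
    hammingNorm (phi m (a, u)) * 2 = 2 ^ m := by
  obtain ⟨i, hi⟩ := Function.ne_iff.1 hu
  have hi : u i = 1 := (z2 _).resolve_left hi
  let f : (Fin m → ZMod 2) →+ ZMod 2 :=
    { toFun := fun x => ∑ i, u i * x i
      map_zero' := by simp
      map_add' := by intro x y; simp [mul_add, Finset.sum_add_distrib] }
  have hf : Function.Surjective f := by
    intro b
    exact ⟨Pi.single i b, by simp [f, Pi.single_apply, hi]⟩
  have := aux_fiber f hf (1 + a)
  simp only [ZMod.card, Fintype.card_pi, Finset.prod_const, Finset.card_univ, Fintype.card_fin] at this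
  rw [← this, hammingNorm]
  congr 2
  ext x
  simp only [Finset.mem_filter, Finset.mem_univ, true_and]
  change a + f x ≠ 0 ↔ _
  generalize f x = b
  clear this
  revert a b; decide

def EE {m : ℕ} (t1 t2 t3 : Fin m → ZMod 2) : (ZMod 2 × (Fin m → ZMod 2)) →+ (ZMod 2 × ZMod 2 × ZMod 2) where
  toFun p := (phi m p t1, phi m p t2, phi m p t3)
  map_zero' := by simp
  map_add' p q := by simp

theorem EE_surj {m : ℕ} {t1 t2 t3 : Fin m → ZMod 2}
    (h12 : t1 ≠ t2) (h13 : t1 ≠ t3) (h23 : t2 ≠ t3) : Function.Surjective (EE t1 t2 t3) := by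
  rintro ⟨a, b, c⟩
  obtain ⟨p, hp⟩ := sep3 h12 h13
  obtain ⟨q, hq⟩ := sep3 h12.symm h23
  obtain ⟨r, hr⟩ := sep3 h13.symm h23.symm
  refine ⟨a • p + b • q + c • r, ?_⟩
  simp [EE, hp, hq, hr]

theorem EE_fiber {m : ℕ} (hm : 3 ≤ m) {t1 t2 t3 : Fin m → ZMod 2}
    (h12 : t1 ≠ t2) (h13 : t1 ≠ t3) (h23 : t2 ≠ t3) (b) :
    (univ.filter (fun p => EE t1 t2 t3 p = b)).card = 2 ^ (m - 2) := by
  have := aux_fiber _ (EE_surj h12 h13 h23) b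
  obtain ⟨k, rfl⟩ : ∃ k, m = k + 2 := ⟨m - 2, by omega⟩
  simp only [Fintype.card_prod, ZMod.card, Fintype.card_pi, Finset.prod_const, Finset.card_univ, Fintype.card_fin] at this
  simp only [Nat.add_sub_cancel]
  rw [pow_add] at this
  omega

theorem wt_restrict {m : ℕ} (T : Finset (Fin m → ZMod 2)) (c : (Fin m → ZMod 2) → ZMod 2) :
    hammingNorm (restrictTo T c) + (T.filter (fun x => c x ≠ 0)).card = hammingNorm c := by
  have h1 : hammingNorm (restrictTo T c) = ((univ.filter (fun x => c x ≠ 0)).filter (· ∉ T)).card := by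
    rw [hammingNorm, ← Finset.card_map (Function.Embedding.subtype _)]
    congr 1
    ext x
    simp only [Finset.mem_map, Finset.mem_filter, Finset.mem_univ, true_and]
    constructor
    · rintro ⟨y, hy, rfl⟩
      exact ⟨hy, y.2⟩
    · rintro ⟨h1, h2⟩
      exact ⟨⟨x, h2⟩, h1, rfl⟩
  have h2 : T.filter (fun x => c x ≠ 0) = (univ.filter (fun x => c x ≠ 0)).filter (¬ · ∉ T) := by
    ext x
    simp [and_comm]
  rw [h1, h2, Finset.card_filter_add_card_filter_not]
  rfl

def cnt (b : ZMod 2 × ZMod 2 × ZMod 2) : ℕ :=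
  (if b.1 ≠ 0 then 1 else 0) + ((if b.2.1 ≠ 0 then 1 else 0) + (if b.2.2 ≠ 0 then 1 else 0))

theorem cnt_eq {m : ℕ} {t1 t2 t3 : Fin m → ZMod 2}
    (h12 : t1 ≠ t2) (h13 : t1 ≠ t3) (h23 : t2 ≠ t3) (p) :
    (({t1, t2, t3} : Finset (Fin m → ZMod 2)).filter (fun x => phi m p x ≠ 0)).card
      = cnt (EE t1 t2 t3 p) := by
  rw [Finset.card_filter, Finset.sum_insert (by simp [h12, h13]), Finset.sum_insert (by simp [h23]),
    Finset.sum_singleton]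
  rfl

theorem cnt_card {m : ℕ} (hm : 3 ≤ m) {t1 t2 t3 : Fin m → ZMod 2}
    (h12 : t1 ≠ t2) (h13 : t1 ≠ t3) (h23 : t2 ≠ t3) (j : ℕ) :
    (univ.filter (fun p => cnt (EE t1 t2 t3 p) = j)).card
      = (univ.filter (fun b => cnt b = j)).card * 2 ^ (m - 2) := by
  rw [Finset.card_eq_sum_card_fiberwise (f := EE t1 t2 t3) (t := univ.filter (fun b => cnt b = j))
    (by intro p hp; simpa using hp)]
  rw [Finset.sum_const_nat (m := 2 ^ (m - 2))]
  intro b hb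
  rw [← EE_fiber hm h12 h13 h23 b, Finset.filter_filter]
  congr 1
  ext p
  simp only [Finset.mem_filter, Finset.mem_univ, true_and] at hb ⊢
  constructor
  · exact fun h => h.2
  · intro h; exact ⟨h ▸ hb, h⟩

theorem cnt_le (b) : cnt b ≤ 3 := by revert b; decide

abbrev psi {m : ℕ} (t1 t2 t3 : Fin m → ZMod 2) :=
  (restrictTo ({t1, t2, t3} : Finset (Fin m → ZMod 2))).comp (phi m)

theorem wt_one {m : ℕ} (hm : 3 ≤ m) {t1 t2 t3 : Fin m → ZMod 2}
    (h12 : t1 ≠ t2) (h13 : t1 ≠ t3) (h23 : t2 ≠ t3) :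
    hammingNorm (psi t1 t2 t3 (1, 0)) + 3 = 2 ^ m := by
  have h := wt_restrict {t1, t2, t3} (phi m (1, 0))
  rw [cnt_eq h12 h13 h23] at h
  have h2 : hammingNorm (phi m (1, 0)) = 2 ^ m := by
    simp [hammingNorm, phi_one]
  have h3 : cnt (EE t1 t2 t3 (1, 0)) = 3 := by
    simp [EE, cnt, phi_one]
  rw [h2, h3] at h
  exact h

theorem wt_gen {m : ℕ} (hm : 3 ≤ m) {t1 t2 t3 : Fin m → ZMod 2}
    (h12 : t1 ≠ t2) (h13 : t1 ≠ t3) (h23 : t2 ≠ t3) (p) (hp : p ≠ 0) (hp' : p ≠ (1, 0)) :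
    hammingNorm (psi t1 t2 t3 p) + cnt (EE t1 t2 t3 p) = 2 ^ (m - 1) := by
  have h := wt_restrict {t1, t2, t3} (phi m p)
  rw [cnt_eq h12 h13 h23] at h
  obtain ⟨a, u⟩ := p
  have hu : u ≠ 0 := by
    rintro rfl
    rcases z2 a with rfl | rfl
    · exact hp rfl
    · exact hp' rfl
  have h2 := wt_phi a u hu
  obtain ⟨k, rfl⟩ : ∃ k, m = k + 1 := ⟨m - 1, by omega⟩
  rw [pow_succ] at h2
  simp only [Nat.add_sub_cancel]
  rw [LinearMap.comp_apply]
  omega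

theorem punct_eq {m : ℕ} (t1 t2 t3 : Fin m → ZMod 2) :
    dualCode (shortenedCode (RMm2 m) {t1, t2, t3}) = LinearMap.range (psi t1 t2 t3) := by
  rw [RMm2, ← aux_short, aux_dual_dual, puncturedCode, RM1_eq, LinearMap.range_comp]

theorem pow_ge {m : ℕ} (hm : 3 ≤ m) : ∃ N, 2 ≤ N ∧ 2 ^ (m - 2) = N ∧ 2 ^ (m - 1) = 2 * N ∧ 2 ^ m = 4 * N := by
  obtain ⟨k, rfl⟩ : ∃ k, m = k + 3 := ⟨m - 3, by omega⟩
  refine ⟨2 ^ (k + 1), ?_, rfl, ?_, ?_⟩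
  · have := Nat.one_le_two_pow (n := k)
    rw [pow_succ]; omega
  · rw [show k + 3 - 1 = k + 1 + 1 by omega, pow_succ (n := k + 1)]; ring
  · rw [pow_add, pow_add]; ring

theorem psi_inj {m : ℕ} (hm : 3 ≤ m) {t1 t2 t3 : Fin m → ZMod 2}
    (h12 : t1 ≠ t2) (h13 : t1 ≠ t3) (h23 : t2 ≠ t3) : Function.Injective (psi t1 t2 t3) := by
  rw [injective_iff_map_eq_zero]
  intro p hp
  by_contra h0
  have hn : hammingNorm (psi t1 t2 t3 p) = 0 := by rw [hp, hammingNorm_zero]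
  obtain ⟨N, hN, e1, e2, e3⟩ := pow_ge hm
  by_cases h1 : p = (1, 0)
  · subst h1
    have := wt_one hm h12 h13 h23
    omega
  · have := wt_gen hm h12 h13 h23 p h0 h1
    have := cnt_le (EE t1 t2 t3 p)
    omega

theorem wc {m : ℕ} (hm : 3 ≤ m) {t1 t2 t3 : Fin m → ZMod 2}
    (h12 : t1 ≠ t2) (h13 : t1 ≠ t3) (h23 : t2 ≠ t3) (k : ℕ) :
    weightCount (dualCode (shortenedCode (RMm2 m) {t1, t2, t3})) k =
      (univ.filter (fun p => hammingNorm (psi t1 t2 t3 p) = k)).card := by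
  rw [punct_eq, weightCount, ← Fintype.card_subtype, ← Nat.card_eq_fintype_card]
  symm
  refine Nat.card_congr (Equiv.ofBijective
    (fun p : {p // hammingNorm (psi t1 t2 t3 p) = k} => ⟨psi t1 t2 t3 p.1, ⟨p.1, rfl⟩, p.2⟩) ⟨?_, ?_⟩)
  · intro p q h
    exact Subtype.ext (psi_inj hm h12 h13 h23 (congrArg Subtype.val h))
  · rintro ⟨_, ⟨p, rfl⟩, hp⟩
    exact ⟨⟨p, hp⟩, rfl⟩

theorem RMm2_wt {m : ℕ} (hm : 3 ≤ m) (c) (hc : c ∈ RMm2 m) (h0 : c ≠ 0) : 4 ≤ hammingNorm c := by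
  by_contra hlt
  obtain ⟨s, hs⟩ := Function.ne_iff.1 h0
  have hs : c s ≠ 0 := hs
  set S := univ.filter (fun x => c x ≠ 0) with hS
  have hcard : S.card ≤ 3 := by
    have : S.card = hammingNorm c := rfl
    omega
  obtain ⟨N, hN, e1, e2, e3⟩ := pow_ge hm
  obtain ⟨U, hSU, hU⟩ := Finset.exists_superset_card_eq hcard (by simp; omega)
  have hsU : s ∈ U := hSU (by simp [hS, hs])
  have hc2 : (U.erase s).card = 2 := by rw [Finset.card_erase_of_mem hsU, hU]
  obtain ⟨a, b, hab, he⟩ := Finset.card_eq_two.1 hc2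
  have ha : a ≠ s := (Finset.mem_erase.1 (he ▸ (by simp : a ∈ ({a, b} : Finset _)))).1
  have hb : b ≠ s := (Finset.mem_erase.1 (he ▸ (by simp : b ∈ ({a, b} : Finset _)))).1
  obtain ⟨p, hp1, hp2, hp3⟩ := sep3 ha.symm hb.symm
  have := hc (phi m p) (by rw [RM1_eq]; exact ⟨p, rfl⟩)
  rw [Finset.sum_eq_single s] at this
  · rw [hp1, mul_one] at this; exact hs this
  · intro x _ hx
    by_cases hcx : c x = 0
    · simp [hcx]
    have : x ∈ U.erase s := Finset.mem_erase.2 ⟨hx, hSU (by simp [hS, hcx])⟩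
    rw [he] at this
    simp only [Finset.mem_insert, Finset.mem_singleton] at this
    rcases this with rfl | rfl
    · simp [hp2]
    · simp [hp3]
  · simp

theorem short_exists {m : ℕ} (hm : 3 ≤ m) {t1 t2 t3 : Fin m → ZMod 2}
    (h12 : t1 ≠ t2) (h13 : t1 ≠ t3) (h23 : t2 ≠ t3) :
    ∃ c ∈ RMm2 m ⊓ zeroOn {t1, t2, t3}, hammingNorm c = 4 := by
  obtain ⟨N, hN, e1, e2, e3⟩ := pow_ge hm
  obtain ⟨v, hv⟩ : ∃ v, v ∉ ({0, t1 + t2, t1 + t3, t2 + t3} : Finset (Fin m → ZMod 2)) := by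
    by_contra! h
    have h1 := Finset.card_le_four (a := 0) (b := t1 + t2) (c := t1 + t3) (d := t2 + t3)
    rw [(Finset.eq_univ_iff_forall.2 h : _ = univ)] at h1
    simp at h1
    omega
  have hd : ∀ x y : Fin m → ZMod 2, x + y = 0 ↔ x = y := by
    intro x y
    simp only [funext_iff]
    refine forall_congr' fun i => ?_
    simp only [Pi.add_apply, Pi.zero_apply]
    exact CharTwo.add_eq_zero
  simp only [Finset.mem_insert, Finset.mem_singleton, not_or] at hv
  obtain ⟨v0, v1, v2, v3⟩ := hv
  let S : Finset (Fin m → ZMod 2) := {t1 + v, t2 + v, t3 + v, t1 + t2 + t3 + v}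
  have n12 : t1 + v ≠ t2 + v := by simpa using h12
  have n13 : t1 + v ≠ t3 + v := by simpa using h13
  have n23 : t2 + v ≠ t3 + v := by simpa using h23
  have key : ∀ x y : Fin m → ZMod 2, x ≠ y → ∀ z w, x + y = z + w → z ≠ w := by
    intro x y hxy z w h hzw
    rw [← hd] at hzw
    exact hxy ((hd _ _).1 (h.trans hzw))
  have two : ∀ x : Fin m → ZMod 2, x + x = 0 := fun x => (hd x x).2 rfl
  have n14 : t1 + v ≠ t1 + t2 + t3 + v := key _ _ h23 _ _ (by linear_combination -two t1 - two v)
  have n24 : t2 + v ≠ t1 + t2 + t3 + v := key _ _ h13 _ _ (by linear_combination -two t2 - two v)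
  have n34 : t3 + v ≠ t1 + t2 + t3 + v := key _ _ h12 _ _ (by linear_combination -two t3 - two v)
  have m1 : t1 + v ∉ ({t2 + v, t3 + v, t1 + t2 + t3 + v} : Finset (Fin m → ZMod 2)) := by
    simp only [Finset.mem_insert, Finset.mem_singleton, not_or]; exact ⟨n12, n13, n14⟩
  have m2 : t2 + v ∉ ({t3 + v, t1 + t2 + t3 + v} : Finset (Fin m → ZMod 2)) := by
    simp only [Finset.mem_insert, Finset.mem_singleton, not_or]; exact ⟨n23, n24⟩
  have m3 : t3 + v ∉ ({t1 + t2 + t3 + v} : Finset (Fin m → ZMod 2)) := by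
    simp only [Finset.mem_singleton]; exact n34
  refine ⟨fun x => if x ∈ S then 1 else 0, ⟨?_, ?_⟩, ?_⟩
  · intro c hc
    rw [RM1_eq] at hc
    obtain ⟨p, rfl⟩ := hc
    simp only [ite_mul, one_mul, zero_mul, Finset.sum_ite_mem, Finset.univ_inter]
    simp only [S]
    rw [Finset.sum_insert m1, Finset.sum_insert m2, Finset.sum_insert m3, Finset.sum_singleton]
    simp only [phi_apply, Pi.add_apply, mul_add, Finset.sum_add_distrib]
    generalize ∑ i, p.2 i * t1 i = a
    generalize ∑ i, p.2 i * t2 i = b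
    generalize ∑ i, p.2 i * t3 i = c
    generalize ∑ i, p.2 i * v i = d
    generalize p.1 = e
    clear * -
    revert a b c d e; decide
  · have n0 := Ne.symm v0
    have z1 : ∀ t, t ≠ t + v := fun t => key _ _ v0 _ _ (by linear_combination -two t)
    intro i hi
    simp only [Finset.mem_insert, Finset.mem_singleton] at hi
    have : i ∉ S := by
      simp only [S, Finset.mem_insert, Finset.mem_singleton, not_or]
      rcases hi with rfl | rfl | rfl
      · exact ⟨z1 _, key _ _ v1 _ _ (by abel), key _ _ v2 _ _ (by abel), key _ _ v3 _ _ (by linear_combination -two i)⟩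
      · exact ⟨key _ _ v1 _ _ (by abel), z1 _, key _ _ v3 _ _ (by abel), key _ _ v2 _ _ (by linear_combination -two i)⟩
      · exact ⟨key _ _ v2 _ _ (by abel), key _ _ v3 _ _ (by abel), z1 _, key _ _ v1 _ _ (by linear_combination -two i)⟩
    simp [this]
  · have : hammingNorm (fun x => if x ∈ S then (1 : ZMod 2) else 0) = S.card := by
      simp [hammingNorm]
    rw [this]
    simp only [S]
    rw [Finset.card_insert_of_notMem m1, Finset.card_insert_of_notMem m2, Finset.card_insert_of_notMem m3, Finset.card_singleton]

theorem norm_short {m : ℕ} (T : Finset (Fin m → ZMod 2)) (c) (hc : c ∈ zeroOn (F := ZMod 2) T) :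
    hammingNorm (restrictTo T c) = hammingNorm c := by
  rw [← wt_restrict T c, Finset.filter_false_of_mem]
  · rfl
  · intro x hx; simpa using hc x hx

/-- Parameters of the thrice-shortened Reed-Muller code `R(m-2,m)_{{t₁,t₂,t₃}}` and the
weight enumerator of its dual. -/
theorem statement17 {m : ℕ} (hm : 3 ≤ m) (t1 t2 t3 : Fin m → ZMod 2)
    (h12 : t1 ≠ t2) (h13 : t1 ≠ t3) (h23 : t2 ≠ t3) :
    Nat.card {x : Fin m → ZMod 2 // x ∉ ({t1, t2, t3} : Finset (Fin m → ZMod 2))}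
      = 2 ^ m - 3 ∧
    -- (1) `(R(m-2,m)_{{t₁,t₂,t₃}})^⊥` is a `[2^m-3, m+1, 2^{m-1}-3]` code with weight
    -- enumerator `1 + (2^{m-2}-1)z^{2^{m-1}-3} + 3·2^{m-2} z^{2^{m-1}-2}
    --   + 3·2^{m-2} z^{2^{m-1}-1} + (2^{m-2}-1)z^{2^{m-1}} + z^{2^m-3}`.
    Module.finrank (ZMod 2) ↥(dualCode (shortenedCode (RMm2 m) {t1, t2, t3})) = m + 1 ∧
    IsMinDist (dualCode (shortenedCode (RMm2 m) {t1, t2, t3})) (2 ^ (m - 1) - 3) ∧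
    weightCount (dualCode (shortenedCode (RMm2 m) {t1, t2, t3})) 0 = 1 ∧
    weightCount (dualCode (shortenedCode (RMm2 m) {t1, t2, t3})) (2 ^ (m - 1) - 3)
      = 2 ^ (m - 2) - 1 ∧
    weightCount (dualCode (shortenedCode (RMm2 m) {t1, t2, t3})) (2 ^ (m - 1) - 2)
      = 3 * 2 ^ (m - 2) ∧
    weightCount (dualCode (shortenedCode (RMm2 m) {t1, t2, t3})) (2 ^ (m - 1) - 1)
      = 3 * 2 ^ (m - 2) ∧
    weightCount (dualCode (shortenedCode (RMm2 m) {t1, t2, t3})) (2 ^ (m - 1))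
      = 2 ^ (m - 2) - 1 ∧
    weightCount (dualCode (shortenedCode (RMm2 m) {t1, t2, t3})) (2 ^ m - 3) = 1 ∧
    (∀ k : ℕ, k ≠ 0 → k ≠ 2 ^ (m - 1) - 3 → k ≠ 2 ^ (m - 1) - 2 → k ≠ 2 ^ (m - 1) - 1 →
      k ≠ 2 ^ (m - 1) → k ≠ 2 ^ m - 3 →
      weightCount (dualCode (shortenedCode (RMm2 m) {t1, t2, t3})) k = 0) ∧
    -- (2) `R(m-2,m)_{{t₁,t₂,t₃}}` is a `[2^m-3, 2^m-m-4, 4]` code.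
    Module.finrank (ZMod 2) ↥(shortenedCode (RMm2 m) {t1, t2, t3}) = 2 ^ m - m - 4 ∧
    IsMinDist (shortenedCode (RMm2 m) {t1, t2, t3}) 4 := by
  obtain ⟨N, hN, e1, e2, e3⟩ := pow_ge hm
  have w1 := wt_one hm h12 h13 h23
  have wg := wt_gen hm h12 h13 h23
  have hc0 : hammingNorm (psi t1 t2 t3 0) = 0 := by rw [map_zero, hammingNorm_zero]
  have hcard : Fintype.card {x : Fin m → ZMod 2 // x ∉ ({t1, t2, t3} : Finset (Fin m → ZMod 2))}
      = 2 ^ m - 3 := by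
    rw [Fintype.card_subtype_compl, Fintype.card_coe, Finset.card_eq_three.2 ⟨t1, t2, t3, h12, h13, h23, rfl⟩]
    simp
  have hfr : Module.finrank (ZMod 2) ↥(dualCode (shortenedCode (RMm2 m) {t1, t2, t3})) = m + 1 := by
    rw [punct_eq, LinearMap.finrank_range_of_inj (psi_inj hm h12 h13 h23)]
    simp [add_comm]
  have E0 : cnt (EE t1 t2 t3 0) = 0 := by rw [map_zero]; rfl
  have E1 : cnt (EE t1 t2 t3 (1, 0)) = 3 := by simp [EE, cnt, phi_one]
  have n10 : ((1, 0) : ZMod 2 × (Fin m → ZMod 2)) ≠ 0 := by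
    intro h; exact absurd (show (1 : ZMod 2) = 0 from congrArg Prod.fst h) (by decide)
  have tri : ∀ p : ZMod 2 × (Fin m → ZMod 2), p = 0 ∨ p = (1, 0) ∨ (p ≠ 0 ∧ p ≠ (1, 0)) := by intro p; tauto
  have C3 := cnt_card hm h12 h13 h23 3
  have C2 := cnt_card hm h12 h13 h23 2
  have C1 := cnt_card hm h12 h13 h23 1
  have C0 := cnt_card hm h12 h13 h23 0
  rw [show (univ.filter (fun b => cnt b = 3)).card = 1 by decide, one_mul] at C3
  rw [show (univ.filter (fun b => cnt b = 2)).card = 3 by decide] at C2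
  rw [show (univ.filter (fun b => cnt b = 1)).card = 3 by decide] at C1
  rw [show (univ.filter (fun b => cnt b = 0)).card = 1 by decide, one_mul] at C0
  have W : ∀ p, (p = 0 ∧ hammingNorm (psi t1 t2 t3 p) = 0 ∧ cnt (EE t1 t2 t3 p) = 0) ∨
      (p = (1, 0) ∧ hammingNorm (psi t1 t2 t3 p) + 3 = 2 ^ m ∧ cnt (EE t1 t2 t3 p) = 3) ∨
      (p ≠ 0 ∧ p ≠ (1, 0) ∧ hammingNorm (psi t1 t2 t3 p) + cnt (EE t1 t2 t3 p) = 2 ^ (m - 1)) := by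
    intro p
    rcases tri p with rfl | rfl | h
    · exact Or.inl ⟨rfl, hc0, E0⟩
    · exact Or.inr (Or.inl ⟨rfl, w1, E1⟩)
    · exact Or.inr (Or.inr ⟨h.1, h.2, wg p h.1 h.2⟩)
  have K3 : weightCount (dualCode (shortenedCode (RMm2 m) {t1, t2, t3})) (2 ^ (m - 1) - 3)
      = 2 ^ (m - 2) - 1 := by
    rw [wc hm h12 h13 h23, ← C3, ← Finset.card_erase_of_mem (a := (1, 0)) (by simp [E1])]
    congr 1
    ext p
    simp only [Finset.mem_filter, Finset.mem_univ, true_and, Finset.mem_erase]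
    have := cnt_le (EE t1 t2 t3 p)
    rcases W p with ⟨h, h', h''⟩ | ⟨h, h', h''⟩ | ⟨h, h', h''⟩
    · simp only [h', h'']; omega
    · simp only [h, ne_eq, not_true, false_and, iff_false]; rw [h] at h'; omega
    · simp only [ne_eq, h', not_false_eq_true, true_and]; omega
  refine ⟨by rw [Nat.card_eq_fintype_card, hcard], hfr, ⟨?_, ?_⟩, ?_, K3, ?_, ?_, ?_, ?_, ?_, ?_, ?_, ?_⟩
  · have : 0 < weightCount (dualCode (shortenedCode (RMm2 m) {t1, t2, t3})) (2 ^ (m - 1) - 3) := by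
      rw [K3]; omega
    obtain ⟨⟨c, hc, hc'⟩⟩ := (Nat.card_pos_iff.1 this).1
    refine ⟨c, hc, ?_, hc'⟩
    rintro rfl
    rw [hammingNorm_zero] at hc'
    omega
  · rw [punct_eq]
    rintro _ ⟨p, rfl⟩ hp
    have := cnt_le (EE t1 t2 t3 p)
    rcases W p with ⟨h, h', h''⟩ | ⟨h, h', h''⟩ | ⟨h, h', h''⟩
    · rw [h, map_zero] at hp; exact absurd rfl hp
    · omega
    · omega
  · rw [wc hm h12 h13 h23, Finset.card_eq_one]
    refine ⟨0, ?_⟩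
    ext p
    simp only [Finset.mem_filter, Finset.mem_univ, true_and, Finset.mem_singleton]
    have := cnt_le (EE t1 t2 t3 p)
    rcases W p with ⟨h, h', h''⟩ | ⟨h, h', h''⟩ | ⟨h, h', h''⟩
    · exact ⟨fun _ => h, fun _ => h'⟩
    · exact ⟨fun _ => by omega, fun h0 => absurd (h.symm.trans h0) n10⟩
    · exact ⟨fun _ => by omega, fun h0 => absurd h0 h⟩
  · rw [wc hm h12 h13 h23, ← C2]
    congr 1
    ext p
    simp only [Finset.mem_filter, Finset.mem_univ, true_and]
    have := cnt_le (EE t1 t2 t3 p)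
    rcases W p with ⟨h, h', h''⟩ | ⟨h, h', h''⟩ | ⟨h, h', h''⟩ <;> omega
  · rw [wc hm h12 h13 h23, ← C1]
    congr 1
    ext p
    simp only [Finset.mem_filter, Finset.mem_univ, true_and]
    have := cnt_le (EE t1 t2 t3 p)
    rcases W p with ⟨h, h', h''⟩ | ⟨h, h', h''⟩ | ⟨h, h', h''⟩ <;> omega
  · rw [wc hm h12 h13 h23, ← C0, ← Finset.card_erase_of_mem (a := 0) (by rw [Finset.mem_filter]; exact ⟨Finset.mem_univ _, E0⟩)]
    congr 1
    ext p
    simp only [Finset.mem_filter, Finset.mem_univ, true_and, Finset.mem_erase]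
    have := cnt_le (EE t1 t2 t3 p)
    rcases W p with ⟨h, h', h''⟩ | ⟨h, h', h''⟩ | ⟨h, h', h''⟩
    · simp only [h, ne_eq, not_true, false_and, iff_false]; rw [h] at h'; omega
    · omega
    · simp only [ne_eq, h, not_false_eq_true, true_and]; omega
  · rw [wc hm h12 h13 h23, Finset.card_eq_one]
    refine ⟨(1, 0), ?_⟩
    ext p
    simp only [Finset.mem_filter, Finset.mem_univ, true_and, Finset.mem_singleton]
    have := cnt_le (EE t1 t2 t3 p)
    rcases W p with ⟨h, h', h''⟩ | ⟨h, h', h''⟩ | ⟨h, h', h''⟩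
    · exact ⟨fun _ => by omega, fun h0 => absurd (h0.symm.trans h) n10⟩
    · exact ⟨fun _ => h, fun _ => by omega⟩
    · exact ⟨fun _ => by omega, fun h0 => absurd h0 h'⟩
  · intro k k0 k3 k2 k1 kM kf
    rw [wc hm h12 h13 h23, Finset.card_eq_zero, Finset.filter_eq_empty_iff]
    intro p _
    have := cnt_le (EE t1 t2 t3 p)
    rcases W p with ⟨h, h', h''⟩ | ⟨h, h', h''⟩ | ⟨h, h', h''⟩ <;> omega
  · have h := aux_finrank (dualCode (shortenedCode (RMm2 m) {t1, t2, t3}))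
    rw [aux_dual_dual, hfr, hcard] at h
    rw [h]; omega
  · obtain ⟨c, hc, hc4⟩ := short_exists hm h12 h13 h23
    have hn := (norm_short _ c hc.2).trans hc4
    refine ⟨restrictTo _ c, ⟨c, hc, rfl⟩, ?_, hn⟩
    intro h0
    rw [h0, hammingNorm_zero] at hn
    omega
  · rintro _ ⟨c, hc, rfl⟩ h0
    rw [norm_short _ c hc.2]
    refine RMm2_wt hm c hc.1 ?_
    rintro rfl
    exact h0 (map_zero _)
end

section
/- Let q ≥ 4 be a prime power, let C be any [q^2+1, 4, q^2−q] code over GF(q), and let t_1 be any coordinate position. Then: (1) C_{{t_1}} is a [q^2, 3, q^2−q] code over GF(q) with weight enumerator 1 + q(q^2−1)z^{q^2−q} + (q−1)z^{q^2}; (2) (C_{{t_1}})^⊥ is a [q^2, q^2−3, 3] code over GF(q); (3) ((C^⊥)_{{t_1}})^⊥ is a [q^2, 4, q^2−q−1] code over GF(q) with weight enumerator 1 + q^2(q−1)^2 z^{q^2−q−1} + q(q^2−1)z^{q^2−q} + q^2(q−1)z^{q^2−1} + (q−1)z^{q^2}; and (4) (C^⊥)_{{t_1}} is a [q^2, q^2−4,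 4] code over GF(q) whose weight distribution satisfies (q^2+1)·C(q^2, k−1)·A_k((C^⊥)_{{t_1}}) = k·C(q^2, k)·A_k(C^⊥) for all 1 ≤ k ≤ q^2, where C(a,b) denotes the binomial coefficient. -/
open Finset

set_option linter.unusedSectionVars false

section Helpers

variable {F : Type} [Field F] {ι : Type} [Fintype ι]

lemma mem_dualCode {C : Submodule F (ι → F)} {x : ι → F} :
    x ∈ dualCode C ↔ ∀ c ∈ C, ∑ i, x i * c i = 0 := Iff.rfl

lemma mem_zeroOn {T : Finset ι} {x : ι → F} :
    x ∈ (zeroOn T : Submodule F (ι → F)) ↔ ∀ i ∈ T, x i = 0 := Iff.rfl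

lemma finrank_dual_add (C : Submodule F (ι → F)) :
    Module.finrank F C + Module.finrank F (dualCode C) = Fintype.card ι := by
  classical
  have h : dualCode C = C.dualAnnihilator.comap (dotProductEquiv F ι).toLinearMap := by
    ext x
    simp [mem_dualCode, Submodule.mem_dualAnnihilator, dotProduct]
  have h2 := Subspace.finrank_add_finrank_dualAnnihilator_eq C
  have h3 := LinearEquiv.finrank_eq
    ((dotProductEquiv F ι).ofSubmodule' C.dualAnnihilator)
  rw [h]
  simp only [Module.finrank_fintype_fun_eq_card] at h2
  rw [← h2, ← h3]

lemma dual_dual (C : Submodule F (ι → F)) : dualCode (dualCode C) = C := by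
  symm
  apply Submodule.eq_of_le_of_finrank_eq
  · intro c hc x hx
    rw [← hx c hc]
    exact Finset.sum_congr rfl fun i _ => mul_comm _ _
  · have h1 := finrank_dual_add C
    have h2 := finrank_dual_add (dualCode C)
    omega

variable [DecidableEq ι]

lemma sum_split (t : ι) (f : ι → F) :
    ∑ i, f i = f t + ∑ j : {i : ι // i ∉ ({t} : Finset ι)}, f j := by
  rw [← Finset.add_sum_erase _ _ (mem_univ t)]
  congr 1
  apply Finset.sum_subtype
  intro x; simp

lemma shortened_dual (C : Submodule F (ι → F)) (t : ι) :
    shortenedCode (dualCode C) {t} = dualCode (puncturedCode C {t}) := by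
  ext x
  constructor
  · rintro ⟨y, ⟨hy, hy0⟩, rfl⟩ c ⟨d, hd, rfl⟩
    have h := hy d hd
    have h0 : y t = 0 := hy0 t (by simp)
    rw [sum_split t, h0, zero_mul, zero_add] at h
    exact h
  · intro hx
    refine ⟨fun i => if h : i ∉ ({t} : Finset ι) then x ⟨i, h⟩ else 0, ⟨?_, ?_⟩, ?_⟩
    · intro c hc
      have := hx _ ⟨c, hc, rfl⟩
      rw [sum_split t]
      simp only [mem_singleton, not_true_eq_false, dite_false, zero_mul, zero_add]
      rw [← this]
      apply Finset.sum_congr rfl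
      rintro ⟨i, hi⟩ _
      rw [dif_pos (by simpa using hi)]
      rfl
    · intro i hi
      simp only [mem_singleton] at hi
      simp [hi]
    · ext ⟨i, hi⟩
      change (if h : i ∉ ({t} : Finset ι) then x ⟨i, h⟩ else 0) = _
      rw [dif_pos hi]

variable [DecidableEq F]

/-- number of zeros -/
def zc (c : ι → F) : ℕ := #{i | c i = 0}

lemma zc_add (c : ι → F) : zc c + hammingNorm c = Fintype.card ι := by
  unfold zc hammingNorm
  exact Finset.card_filter_add_card_filter_not _

lemma norm_restrict (t : ι) (c : ι → F) :
    hammingNorm (restrictTo {t} c) + (if c t = 0 then 0 else 1) = hammingNorm c := by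
  unfold hammingNorm
  have h : ∀ i, (c i ≠ 0) = (c i ≠ 0) := fun _ => rfl
  rw [Finset.card_filter, Finset.card_filter, ← Finset.add_sum_erase _ _ (mem_univ t), add_comm]
  congr 1
  · simp
  · symm
    apply Finset.sum_subtype
    intro x; simp

lemma restrict_inj (t : ι) {c d : ι → F} (h : restrictTo {t} c = restrictTo {t} d)
    (ht : c t = d t) : c = d := by
  ext i
  by_cases hi : i = t
  · rw [hi, ht]
  · exact congrFun h ⟨i, by simpa using hi⟩

variable [Fintype F]

lemma weightCount_eq (C : Submodule F (ι → F)) [DecidablePred (· ∈ C)] (k : ℕ) :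
    weightCount C k = #{c : ι → F | c ∈ C ∧ hammingNorm c = k} := by
  unfold weightCount
  rw [Nat.card_eq_fintype_card, Fintype.card_subtype]

lemma weightCount_shortened (C : Submodule F (ι → F)) [DecidablePred (· ∈ C)] (t : ι) (k : ℕ) :
    weightCount (shortenedCode C {t}) k =
      #{c : ι → F | c ∈ C ∧ c t = 0 ∧ hammingNorm c = k} := by
  classical
  rw [weightCount_eq]
  symm
  apply Finset.card_bij (fun c _ => restrictTo {t} c)
  · intro c hc
    simp only [mem_filter, mem_univ, true_and] at hc ⊢
    refine ⟨⟨c, ⟨hc.1, ?_⟩, rfl⟩, ?_⟩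
    · intro i hi
      rw [mem_singleton.1 hi, hc.2.1]
    · have := norm_restrict t c
      rw [if_pos hc.2.1] at this
      rw [← hc.2.2, ← this, add_zero]
  · intro c hc d hd h
    simp only [mem_filter, mem_univ, true_and] at hc hd
    exact restrict_inj t h (by rw [hc.2.1, hd.2.1])
  · intro x hx
    simp only [mem_filter, mem_univ, true_and] at hx
    obtain ⟨⟨c, ⟨hc, hc0⟩, rfl⟩, hk⟩ := hx
    have h0 : c t = 0 := hc0 t (by simp)
    refine ⟨c, ?_, rfl⟩
    simp only [mem_filter, mem_univ, true_and]
    refine ⟨hc, h0, ?_⟩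
    have := norm_restrict t c
    rw [if_pos h0] at this
    rw [← hk, ← this, add_zero]

lemma weightCount_punctured (C : Submodule F (ι → F)) [DecidablePred (· ∈ C)] (t : ι)
    (hinj : ∀ c ∈ C, restrictTo {t} c = 0 → c = 0) (k : ℕ) :
    weightCount (puncturedCode C {t}) k =
      #{c : ι → F | c ∈ C ∧ hammingNorm (restrictTo {t} c) = k} := by
  classical
  rw [weightCount_eq]
  symm
  apply Finset.card_bij (fun c _ => restrictTo {t} c)
  · intro c hc
    simp only [mem_filter, mem_univ, true_and] at hc ⊢
    exact ⟨⟨c, hc.1, rfl⟩, hc.2⟩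
  · intro c hc d hd h
    simp only [mem_filter, mem_univ, true_and] at hc hd
    exact sub_eq_zero.1 (hinj (c - d) (C.sub_mem hc.1 hd.1) (by rw [map_sub, h, sub_self]))
  · intro x hx
    simp only [mem_filter, mem_univ, true_and] at hx
    obtain ⟨⟨c, hc, rfl⟩, hk⟩ := hx
    exact ⟨c, by simpa using ⟨hc, hk⟩, rfl⟩

lemma code_card (C : Submodule F (ι → F)) [DecidablePred (· ∈ C)] :
    #{c : ι → F | c ∈ C} = Fintype.card F ^ Module.finrank F C := by
  rw [← Module.card_eq_pow_finrank (K := F) (V := C)]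
  exact (Fintype.card_subtype _).symm

/-- MacWilliams identity -/
lemma macwilliams (C : Submodule F (ι → F)) [DecidablePred (· ∈ C)]
    [DecidablePred (· ∈ dualCode C)] (x : ℂ) :
    (#{c : ι → F | c ∈ C} : ℂ) * ∑ v : ι → F with v ∈ dualCode C, x ^ hammingNorm v =
      ∑ c : ι → F with c ∈ C,
        (1 + (Fintype.card F - 1) * x) ^ zc c * (1 - x) ^ hammingNorm c := by
  obtain ⟨ψ, hψ⟩ : ∃ ψ : AddChar F ℂ, ψ.IsPrimitive := by
    obtain ⟨ψ, h⟩ := AddChar.exists_apply_ne_zero.2 (one_ne_zero (α := F))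
    refine ⟨ψ, AddChar.IsPrimitive.of_ne_one ?_⟩
    rintro rfl
    simp at h
  have hloc : ∀ b : F, ∑ a : F, (if a = 0 then 1 else x) * ψ (a * b) =
      if b = 0 then 1 + (Fintype.card F - 1) * x else 1 - x := by
    intro b
    have h1 : ∀ a : F, (if a = 0 then 1 else x) * ψ (a * b)
        = x * ψ (a * b) + if a = 0 then 1 - x else 0 := by
      intro a
      split_ifs with h
      · simp [h]
      · simp
    simp_rw [h1]
    rw [Finset.sum_add_distrib, ← Finset.mul_sum, AddChar.sum_mulShift b hψ]
    simp only [Finset.sum_ite_eq', mem_univ, if_true]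
    split_ifs <;> push_cast <;> ring
  have hchar : ∀ v : ι → F, ∑ c : ι → F with c ∈ C, ψ (∑ i, v i * c i) =
      if v ∈ dualCode C then (#{c : ι → F | c ∈ C} : ℂ) else 0 := by
    intro v
    split_ifs with hv
    · rw [Finset.sum_congr rfl (g := fun _ => (1:ℂ))]
      · simp
      · intro c hc
        rw [hv c (by simpa using hc), AddChar.map_zero_eq_one]
    · rw [mem_dualCode] at hv
      push Not at hv
      obtain ⟨d, hd, hne⟩ := hv
      obtain ⟨a, ha⟩ : ∃ a, ψ (a * ∑ i, v i * d i) ≠ 1 := by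
        by_contra! hcon
        apply hψ hne
        ext a
        rw [AddChar.mulShift_apply, mul_comm, hcon]; simp
      have hs : ∑ c : ι → F with c ∈ C, ψ (∑ i, v i * c i) =
          ψ (a * ∑ i, v i * d i) * ∑ c : ι → F with c ∈ C, ψ (∑ i, v i * c i) := by
        rw [Finset.mul_sum]
        symm
        apply Finset.sum_bij (fun c _ => c + a • d)
        · intro c hc
          simp only [mem_filter, mem_univ, true_and] at hc ⊢
          exact C.add_mem hc (C.smul_mem _ hd)
        · intro c _ c' _ h
          simpa using h
        · intro c hc
          simp only [mem_filter, mem_univ, true_and] at hc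
          exact ⟨c - a • d, by simpa using C.sub_mem hc (C.smul_mem _ hd), by simp⟩
        · intro c _
          rw [← AddChar.map_add_eq_mul, Finset.mul_sum, ← Finset.sum_add_distrib]
          congr 1
          apply Finset.sum_congr rfl
          intro i _
          simp only [Pi.add_apply, Pi.smul_apply, smul_eq_mul]; ring
      have : (ψ (a * ∑ i, v i * d i) - 1) * ∑ c : ι → F with c ∈ C, ψ (∑ i, v i * c i) = 0 := by
        rw [sub_mul, one_mul, ← hs, sub_self]
      rcases mul_eq_zero.1 this with h | h
      · exact absurd (sub_eq_zero.1 h) ha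
      · exact h
  have hsum : ∀ f : ι → F, ψ (∑ i, f i) = ∏ i, ψ (f i) := by
    intro f
    exact map_prod ψ.toMonoidHom (fun i => Multiplicative.ofAdd (f i)) univ
  have hw : ∀ v : ι → F, x ^ hammingNorm v = ∏ i, (if v i = 0 then 1 else x) := by
    intro v
    rw [Finset.prod_ite]
    simp [hammingNorm]
  calc _ = ∑ v : ι → F, x ^ hammingNorm v *
        (if v ∈ dualCode C then (#{c : ι → F | c ∈ C} : ℂ) else 0) := by
        rw [Finset.mul_sum, Finset.sum_filter]
        apply Finset.sum_congr rfl
        intro v _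
        split_ifs <;> ring
    _ = ∑ c : ι → F with c ∈ C, ∑ v : ι → F, x ^ hammingNorm v * ψ (∑ i, v i * c i) := by
        rw [Finset.sum_comm]
        apply Finset.sum_congr rfl
        intro v _
        rw [← hchar, Finset.mul_sum]
    _ = _ := by
        apply Finset.sum_congr rfl
        intro c _
        have : ∀ v : ι → F, x ^ hammingNorm v * ψ (∑ i, v i * c i) =
            ∏ i, ((if v i = 0 then 1 else x) * ψ (v i * c i)) := by
          intro v
          rw [hw, hsum, Finset.prod_mul_distrib]
        simp_rw [this]
        rw [← Fintype.piFinset_univ, ← Finset.prod_univ_sum (fun _ : ι => (univ : Finset F))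
          (fun i a => (if a = 0 then 1 else x) * ψ (a * c i))]
        simp_rw [hloc]
        rw [Finset.prod_ite]
        simp [hammingNorm, zc]

lemma sum_by_weight (C : Submodule F (ι → F)) [DecidablePred (· ∈ C)] (g : ℕ → ℂ) :
    ∑ c : ι → F with c ∈ C, g (hammingNorm c) =
      ∑ k ∈ range (Fintype.card ι + 1), (weightCount C k : ℂ) * g k := by
  rw [← Finset.sum_fiberwise_of_maps_to (t := range (Fintype.card ι + 1))
    (g := fun c : ι → F => hammingNorm c)]
  · apply Finset.sum_congr rfl
    intro k _
    rw [weightCount_eq, Finset.filter_filter]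
    rw [Finset.sum_congr rfl (g := fun _ => g k)]
    · simp
    · intro c hc
      simp only [mem_filter] at hc
      rw [hc.2.2]
  · intro c _
    simpa [Nat.lt_succ_iff] using hammingNorm_le_card_fintype

lemma dual_weights_eq {κ : Type} [Fintype κ] [DecidableEq κ] (C : Submodule F (ι → F))
    (D : Submodule F (κ → F)) (hc : Fintype.card ι = Fintype.card κ)
    (h : ∀ k, weightCount C k = weightCount D k) (k : ℕ) :
    weightCount (dualCode C) k = weightCount (dualCode D) k := by
  classical
  by_cases hk : Fintype.card ι < k
  · have e : ∀ {μ : Type} [Fintype μ] [DecidableEq μ] (E : Submodule F (μ → F)),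
        Fintype.card μ < k → weightCount E k = 0 := by
      intro μ _ _ E hE
      rw [weightCount_eq, Finset.card_eq_zero, Finset.filter_eq_empty_iff]
      rintro c - ⟨-, h2⟩
      have := hammingNorm_le_card_fintype (x := c)
      omega
    rw [e _ hk, e _ (hc ▸ hk)]
  have hcard : (#{c : ι → F | c ∈ C} : ℂ) = #{c : κ → F | c ∈ D} := by
    have h1 := sum_by_weight C (fun _ => 1)
    have h2 := sum_by_weight D (fun _ => 1)
    simp only [mul_one, Finset.sum_const, nsmul_eq_mul] at h1 h2
    rw [h1, h2, hc]
    simp_rw [h]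
  have hpos : (#{c : κ → F | c ∈ D} : ℂ) ≠ 0 := by
    rw [Nat.cast_ne_zero, Finset.card_ne_zero]
    exact ⟨0, by simp⟩
  have hx : ∀ x : ℂ, ∑ k ∈ range (Fintype.card ι + 1), (weightCount (dualCode C) k : ℂ) * x ^ k
      = ∑ k ∈ range (Fintype.card ι + 1), (weightCount (dualCode D) k : ℂ) * x ^ k := by
    intro x
    have m1 := macwilliams C x
    have m2 := macwilliams D x
    have z1 : ∀ c : ι → F, zc c = Fintype.card ι - hammingNorm c := fun c => by
      have := zc_add c; omega
    have z2 : ∀ c : κ → F, zc c = Fintype.card κ - hammingNorm c := fun c => by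
      have := zc_add c; omega
    simp_rw [z1] at m1
    simp_rw [z2] at m2
    rw [sum_by_weight C (fun j => (1 + (Fintype.card F - 1) * x) ^ (Fintype.card ι - j) *
      (1 - x) ^ j), sum_by_weight (dualCode C) (fun j => x ^ j)] at m1
    rw [sum_by_weight D (fun j => (1 + (Fintype.card F - 1) * x) ^ (Fintype.card κ - j) *
      (1 - x) ^ j), sum_by_weight (dualCode D) (fun j => x ^ j), ← hc] at m2
    simp_rw [h] at m1
    rw [← m2, hcard] at m1
    exact mul_left_cancel₀ hpos m1
  have hp : (∑ k ∈ range (Fintype.card ι + 1),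
      Polynomial.C (weightCount (dualCode C) k : ℂ) * Polynomial.X ^ k)
      = ∑ k ∈ range (Fintype.card ι + 1),
      Polynomial.C (weightCount (dualCode D) k : ℂ) * Polynomial.X ^ k := by
    apply Polynomial.funext
    intro x
    simpa [Polynomial.eval_finsetSum] using hx x
  have := congrArg (fun p => Polynomial.coeff p k) hp
  simp only [Polynomial.finsetSum_coeff, Polynomial.coeff_C_mul_X_pow] at this
  rw [Finset.sum_ite_eq, Finset.sum_ite_eq, if_pos (by simp; omega), if_pos (by simp; omega)] at this
  exact_mod_cast this

end Helpers

section Ovoid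

variable {F : Type} [Field F] {ι : Type} [Fintype ι] [DecidableEq ι] [DecidableEq F] [Fintype F]

/-- restriction to a set of coordinates -/
def restr (T : Finset ι) : (ι → F) →ₗ[F] (T → F) := LinearMap.funLeft F F Subtype.val

lemma rk (C : Submodule F (ι → F)) (T : Finset ι) :
    Module.finrank F (C.map (restr T)) + Module.finrank F ↥(C ⊓ zeroOn T) =
      Module.finrank F C := by
  have h := LinearMap.finrank_range_add_finrank_ker ((restr T).domRestrict C)
  rw [LinearMap.range_domRestrict] at h
  rw [← h]
  congr 1
  have e : ((LinearMap.ker ((restr T).domRestrict C)).map C.subtype) = C ⊓ zeroOn T := by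
    ext x
    simp only [Submodule.mem_map, LinearMap.mem_ker, Submodule.subtype_apply, Submodule.mem_inf]
    constructor
    · rintro ⟨y, hy, rfl⟩
      refine ⟨y.2, fun i hi => ?_⟩
      exact congrFun hy ⟨i, hi⟩
    · rintro ⟨hx, hx0⟩
      refine ⟨⟨x, hx⟩, ?_, rfl⟩
      ext ⟨i, hi⟩
      exact hx0 i hi
  rw [← e, Submodule.finrank_map_subtype_eq]

lemma map_finrank_le (C : Submodule F (ι → F)) (T : Finset ι) :
    Module.finrank F (C.map (restr T)) ≤ #T := by
  refine (Submodule.finrank_le _).trans ?_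
  simp

lemma sum_zc (S : Finset (ι → F)) : ∑ c ∈ S, zc c = ∑ i, #{c ∈ S | c i = 0} := by
  unfold zc
  simp_rw [Finset.card_filter]
  rw [Finset.sum_comm]

lemma kernel_le (hq : 4 ≤ Fintype.card F) (hn : Fintype.card ι = Fintype.card F ^ 2 + 1)
    (C : Submodule F (ι → F))
    (hz : ∀ c ∈ C, c ≠ 0 → zc c ≤ Fintype.card F + 1) (T : Finset ι) (hT : #T = 3) :
    Module.finrank F ↥(C ⊓ zeroOn T) ≤ 1 := by
  classical
  by_contra! hm
  set q := Fintype.card F with hqdef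
  set K : Submodule F (ι → F) := C ⊓ zeroOn T with hK
  obtain ⟨m, hm'⟩ : ∃ m, Module.finrank F K = m + 2 := ⟨_, (Nat.sub_add_cancel hm).symm⟩
  have hcK := code_card K
  rw [hm'] at hcK
  have h1 := sum_zc ({c : ι → F | c ∈ K} : Finset (ι → F))
  have hup : ∑ c ∈ ({c : ι → F | c ∈ K} : Finset (ι → F)), zc c ≤
      (q ^ (m+2) - 1) * (q + 1) + (q ^ 2 + 1) := by
    rw [← Finset.sum_erase_add _ _ (a := 0) (by simp)]
    apply Nat.add_le_add
    · refine (Finset.sum_le_card_nsmul _ _ (q + 1) ?_).trans ?_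
      · intro c hc
        simp only [mem_erase, mem_filter, mem_univ, true_and] at hc
        exact hz c hc.2.1 hc.1
      · rw [Finset.card_erase_of_mem (by simp), hcK, smul_eq_mul]
    · unfold zc; simp [hn]
  have hlo : ∀ i, (if i ∈ T then q ^ (m+2) else q ^ (m+1)) ≤
      #{c ∈ ({c : ι → F | c ∈ K} : Finset (ι → F)) | c i = 0} := by
    intro i
    split_ifs with hi
    · rw [← hcK]
      apply Finset.card_le_card
      intro c hc
      simp only [mem_filter, mem_univ, true_and] at hc ⊢
      exact ⟨hc, hc.2 i hi⟩
    · have e1 := rk K {i}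
      have e2 := map_finrank_le K {i}
      rw [Finset.card_singleton] at e2
      have e3 := code_card (K ⊓ zeroOn {i})
      have e4 : #{c ∈ ({c : ι → F | c ∈ K} : Finset (ι → F)) | c i = 0} =
          q ^ Module.finrank F ↥(K ⊓ zeroOn {i}) := by
        rw [← e3, Finset.filter_filter]
        congr 1
        ext c
        simp [mem_zeroOn]
      rw [e4]
      exact Nat.pow_le_pow_right (by omega) (by omega)
  have h2 := Finset.sum_le_sum (s := univ) (fun i _ => hlo i)
  rw [← h1, Finset.sum_ite] at h2
  have h3 := h2.trans hup
  have c1 : #{i : ι | i ∈ T} = 3 := by simpa using hT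
  have c2 : #{i : ι | i ∉ T} = q ^ 2 - 2 := by
    have := Finset.card_filter_add_card_filter_not (s := (univ : Finset ι)) (fun i => i ∈ T)
    rw [c1, Finset.card_univ, hn] at this
    omega
  simp only [Finset.sum_const, smul_eq_mul, c1, c2] at h3
  have hp1 : 1 ≤ q ^ (m + 2) := Nat.one_le_pow _ _ (by omega)
  have hp2 : 2 ≤ q ^ 2 := by nlinarith
  have hp3 : 1 ≤ q ^ m := Nat.one_le_pow _ _ (by omega)
  zify [hp1, hp2] at h3 hq hp3
  rw [pow_add, pow_add] at h3
  generalize (q : ℤ) ^ m = Y at *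
  generalize (q : ℤ) = Q at *
  have : 0 < Q * (Q - 1) := by nlinarith
  nlinarith

/-- The ovoid hypotheses -/
structure Ov (C : Submodule F (ι → F)) : Prop where
  hq : 4 ≤ Fintype.card F
  hn : Fintype.card ι = Fintype.card F ^ 2 + 1
  hd : Module.finrank F C = 4
  hz : ∀ c ∈ C, c ≠ 0 → zc c ≤ Fintype.card F + 1

variable {C : Submodule F (ι → F)}

lemma Ov.surj (h : Ov C) (T : Finset ι) (hT : #T = 3) : C.map (restr T) = ⊤ := by
  have h1 := kernel_le h.hq h.hn C h.hz T hT
  have h2 := rk C T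
  have h3 := map_finrank_le C T
  rw [h.hd] at h2
  apply Submodule.eq_top_of_finrank_eq
  simp only [Module.finrank_fintype_fun_eq_card, Fintype.card_coe]
  omega

lemma Ov.extend (h : Ov C) (T : Finset ι) (hT : #T ≤ 3) : ∃ T', T ⊆ T' ∧ #T' = 3 := by
  apply Finset.exists_superset_card_eq hT
  rw [h.hn]
  have := h.hq
  nlinarith

lemma Ov.exists (h : Ov C) (T : Finset ι) (hT : #T ≤ 3) (y : ι → F) :
    ∃ c ∈ C, ∀ i ∈ T, c i = y i := by
  obtain ⟨T', hs, hT'⟩ := h.extend T hT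
  have : restr T' y ∈ C.map (restr T') := by rw [h.surj T' hT']; trivial
  obtain ⟨c, hc, e⟩ := this
  exact ⟨c, hc, fun i hi => congrFun e ⟨i, hs hi⟩⟩

lemma Ov.count (h : Ov C) [DecidablePred (· ∈ C)] (T : Finset ι) (hT : #T ≤ 3) :
    #{c : ι → F | c ∈ C ∧ ∀ i ∈ T, c i = 0} = Fintype.card F ^ (4 - #T) := by
  classical
  have e := code_card (C ⊓ zeroOn T)
  have e1 : C.map (restr T) = ⊤ := by
    rw [eq_top_iff]
    rintro y -
    obtain ⟨c, hc, hy⟩ := h.exists T hT (fun i => if hi : i ∈ T then y ⟨i, hi⟩ else 0)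
    refine ⟨c, hc, ?_⟩
    ext ⟨i, hi⟩
    change c i = _
    rw [hy i hi, dif_pos hi]
  have e2 := rk C T
  rw [e1, h.hd, finrank_top] at e2
  simp only [Module.finrank_fintype_fun_eq_card, Fintype.card_coe] at e2
  have e3 : Module.finrank F ↥(C ⊓ zeroOn T) = 4 - #T := by omega
  rw [e3] at e
  rw [← e]
  congr 1
  ext c
  simp [mem_zeroOn]

lemma Ov.dual (h : Ov C) (x : ι → F) (hx : x ∈ dualCode C) (hw : hammingNorm x ≤ 3) : x = 0 := by
  by_contra hne
  obtain ⟨j, hj⟩ := Function.ne_iff.1 hne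
  obtain ⟨c, hc, hy⟩ := h.exists ({i | x i ≠ 0} : Finset ι) hw (Pi.single j 1)
  have := hx c hc
  rw [Finset.sum_eq_single j] at this
  · rw [hy j (by simpa using hj)] at this
    simp at this
    exact hj this
  · intro i _ hij
    by_cases hi : x i = 0
    · simp [hi]
    · rw [hy i (by simpa using hi)]; simp [hij]
  · simp

lemma Ov.moment (h : Ov C) [DecidablePred (· ∈ C)] (j : ℕ) (hj : j ≤ 3) :
    ∑ c : ι → F with c ∈ C, (zc c).choose j =
      (Fintype.card F ^ 2 + 1).choose j * Fintype.card F ^ (4 - j) := by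
  have h1 : ∀ c : ι → F, (zc c).choose j =
      #{T ∈ powersetCard j (univ : Finset ι) | ∀ i ∈ T, c i = 0} := by
    intro c
    unfold zc
    rw [← Finset.card_powersetCard]
    congr 1
    ext T
    simp only [mem_powersetCard, mem_filter, subset_iff, mem_univ, true_and, implies_true]
    tauto
  simp_rw [h1, Finset.card_filter]
  rw [Finset.sum_comm]
  rw [Finset.sum_congr rfl (g := fun _ => Fintype.card F ^ (4 - j))]
  · simp [h.hn]
  · intro T hT
    have hT' := (mem_powersetCard.1 hT).2
    rw [← Finset.card_filter, Finset.filter_filter, h.count T (by omega), hT']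

lemma choose_three' (n : ℕ) : (6 : ℤ) * n.choose 3 = n * (n - 1) * (n - 2) := by
  rcases n with _ | _ | n
  · simp
  · simp [Nat.choose]
  · have := Nat.descFactorial_eq_factorial_mul_choose (n + 2) 3
    simp [Nat.descFactorial, Nat.factorial] at this
    zify at this
    push_cast
    linarith

lemma choose_two' (n : ℕ) : (2 : ℤ) * n.choose 2 = n * (n - 1) := by
  rcases n with _ | n
  · simp
  · have := Nat.descFactorial_eq_factorial_mul_choose (n + 1) 2
    simp [Nat.descFactorial, Nat.factorial] at this
    zify at this
    push_cast
    linarith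

lemma Ov.two (h : Ov C) (c : ι → F) (hc : c ∈ C) (hne : c ≠ 0) :
    zc c = 1 ∨ zc c = Fintype.card F + 1 := by
  classical
  set q := Fintype.card F with hqdef
  have m0 := h.moment 0 (by omega)
  have m1 := h.moment 1 (by omega)
  have m2 := h.moment 2 (by omega)
  have m3 := h.moment 3 (by omega)
  rw [← hqdef] at m0 m1 m2 m3
  zify at m0 m1 m2 m3
  simp only [Nat.choose_zero_right, Nat.choose_one_right, Nat.cast_one] at m0 m1
  have c2 := choose_two' (q ^ 2 + 1)
  have c3 := choose_three' (q ^ 2 + 1)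
  have hz0 : zc (0 : ι → F) = q ^ 2 + 1 := by unfold zc; simp [h.hn, hqdef]
  have key : ∑ c : ι → F with c ∈ C, ((zc c : ℤ) - 1) ^ 2 * ((q : ℤ) + 1 - zc c) = (q : ℤ) ^ 5 - (q : ℤ) ^ 6 := by
    have : ∀ c : ι → F, ((zc c : ℤ) - 1) ^ 2 * (q + 1 - zc c) =
        (-6) * ((zc c).choose 3 : ℤ) + 2 * q * ((zc c).choose 2 : ℤ) - (q + 1) * (zc c : ℤ) + (q + 1) * 1 := by
      intro c
      have a2 := choose_two' (zc c)
      have a3 := choose_three' (zc c)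
      linear_combination a3 - q * a2
    simp_rw [this]
    rw [Finset.sum_add_distrib, Finset.sum_sub_distrib, Finset.sum_add_distrib, ← Finset.mul_sum,
      ← Finset.mul_sum, ← Finset.mul_sum, ← Finset.mul_sum, m0, m1, m2, m3]
    push_cast at c2 c3 ⊢
    norm_num
    linear_combination (-q : ℤ) * c3 + (q : ℤ) ^ 3 * c2
  rw [← Finset.sum_erase_add _ _ (a := 0) (by simp), hz0] at key
  have key' : ∑ c ∈ ({c : ι → F | c ∈ C} : Finset (ι → F)).erase 0,
      ((zc c : ℤ) - 1) ^ 2 * (q + 1 - zc c) = 0 := by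
    push_cast at key
    linear_combination key
  rw [Finset.sum_eq_zero_iff_of_nonneg] at key'
  · have := key' c (by simp [hc, hne])
    rcases mul_eq_zero.1 this with h1 | h1
    · left
      have := pow_eq_zero_iff (two_ne_zero) |>.1 h1
      omega
    · right; omega
  · intro c hc
    simp only [mem_erase, mem_filter, mem_univ, true_and] at hc
    have := h.hz c hc.2 hc.1
    apply mul_nonneg (sq_nonneg _)
    rw [← hqdef] at this
    zify at this
    linarith

end Ovoid

section Final

variable {F : Type} [Field F] {ι : Type} [Fintype ι] [DecidableEq ι] [DecidableEq F] [Fintype F]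

variable {C : Submodule F (ι → F)}

lemma Ov.q2 (h : Ov C) : 4 * Fintype.card F ≤ Fintype.card F ^ 2 := by
  have := h.hq
  nlinarith

lemma Ov.wts (h : Ov C) (c : ι → F) (hc : c ∈ C) (hne : c ≠ 0) :
    (zc c = Fintype.card F + 1 ∧ hammingNorm c = Fintype.card F ^ 2 - Fintype.card F) ∨
    (zc c = 1 ∧ hammingNorm c = Fintype.card F ^ 2) := by
  have h1 := h.two c hc hne
  have h2 := zc_add c
  have h3 := h.hn
  have h4 := h.q2
  have h5 := h.hq
  rcases h1 with h1 | h1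
  · right; omega
  · left; omega

lemma Ov.split (h : Ov C) (S : Finset (ι → F)) (hS : ∀ c ∈ S, c ∈ C ∧ c ≠ 0) :
    #S = #{c ∈ S | hammingNorm c = Fintype.card F ^ 2 - Fintype.card F} +
      #{c ∈ S | hammingNorm c = Fintype.card F ^ 2} ∧
    ∑ c ∈ S, zc c = (Fintype.card F + 1) *
      #{c ∈ S | hammingNorm c = Fintype.card F ^ 2 - Fintype.card F} +
      #{c ∈ S | hammingNorm c = Fintype.card F ^ 2} := by
  have h4 := h.q2
  have h5 := h.hq
  constructor
  · rw [Finset.card_filter, Finset.card_filter, ← Finset.sum_add_distrib, Finset.card_eq_sum_ones]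
    apply Finset.sum_congr rfl
    intro c hc
    rcases h.wts c (hS c hc).1 (hS c hc).2 with ⟨_, h2⟩ | ⟨_, h2⟩
    · rw [if_pos h2, if_neg (by omega)]
    · rw [if_pos h2, if_neg (by omega)]
  · rw [Finset.card_filter, Finset.card_filter, Finset.mul_sum, ← Finset.sum_add_distrib]
    apply Finset.sum_congr rfl
    intro c hc
    rcases h.wts c (hS c hc).1 (hS c hc).2 with ⟨h1, h2⟩ | ⟨h1, h2⟩
    · rw [if_pos h2, if_neg (by omega), h1]; ring
    · rw [if_pos h2, if_neg (by omega), h1]; ring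

lemma Ov.zero_card (h : Ov C) [DecidablePred (· ∈ C)] (t : ι) :
    #{c : ι → F | c ∈ C ∧ c t = 0} = Fintype.card F ^ 3 := by
  have := h.count {t} (by simp)
  simpa using this

lemma Ov.zero_sum (h : Ov C) [DecidablePred (· ∈ C)] (t : ι) :
    ∑ c : ι → F with (c ∈ C ∧ c t = 0), zc c = Fintype.card F ^ 3 + Fintype.card F ^ 4 := by
  rw [sum_zc, ← Finset.add_sum_erase _ _ (mem_univ t)]
  congr 1
  · rw [← h.zero_card t, Finset.filter_filter]
    congr 1
    ext c
    simp
  · rw [Finset.sum_congr rfl (g := fun _ => Fintype.card F ^ 2)]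
    · rw [Finset.sum_const, Finset.card_erase_of_mem (mem_univ t), Finset.card_univ, h.hn]
      simp; ring
    · intro i hi
      have hne : t ≠ i := (Finset.ne_of_mem_erase hi).symm
      have hc2 : #({t, i} : Finset ι) = 2 := Finset.card_pair hne
      have := h.count {t, i} (by omega)
      rw [hc2] at this
      simp only [mem_insert, mem_singleton, forall_eq_or_imp, forall_eq] at this
      rw [Finset.filter_filter]
      simp only [and_assoc]
      exact this

lemma Ov.counts (h : Ov C) [DecidablePred (· ∈ C)] (t : ι) :
    #{c : ι → F | c ∈ C ∧ c t = 0 ∧ hammingNorm c = Fintype.card F ^ 2 - Fintype.card F}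
      = Fintype.card F * (Fintype.card F ^ 2 - 1) ∧
    #{c : ι → F | c ∈ C ∧ c t = 0 ∧ hammingNorm c = Fintype.card F ^ 2}
      = Fintype.card F - 1 ∧
    #{c : ι → F | c ∈ C ∧ c t ≠ 0 ∧ hammingNorm c = Fintype.card F ^ 2 - Fintype.card F}
      = Fintype.card F ^ 2 * (Fintype.card F - 1) ^ 2 ∧
    #{c : ι → F | c ∈ C ∧ c t ≠ 0 ∧ hammingNorm c = Fintype.card F ^ 2}
      = Fintype.card F ^ 2 * (Fintype.card F - 1) := by
  have h4 := h.q2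
  have h5 := h.hq
  have z1 := h.zero_card t
  have z2 := h.zero_sum t
  have t1 := h.moment 0 (by omega)
  have t2 := h.moment 1 (by omega)
  simp only [Nat.choose_zero_right, Nat.choose_one_right, ← Finset.card_eq_sum_ones] at t1 t2
  obtain ⟨a1, a2⟩ := h.split (({c : ι → F | c ∈ C ∧ c t = 0} : Finset (ι → F)).erase 0) (by
    intro c hc
    simp only [mem_erase, mem_filter, mem_univ, true_and] at hc
    exact ⟨hc.2.1, hc.1⟩)
  obtain ⟨b1, b2⟩ := h.split ({c : ι → F | c ∈ C ∧ c t ≠ 0} : Finset (ι → F)) (by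
    intro c hc
    simp only [mem_filter, mem_univ, true_and] at hc
    exact ⟨hc.1, fun h0 => hc.2 (by simp [h0])⟩)
  have z0 : zc (0 : ι → F) = Fintype.card F ^ 2 + 1 := by unfold zc; simp [h.hn]
  rw [Finset.card_erase_of_mem (by simp), z1] at a1
  have a2' := Finset.sum_erase_add ({c : ι → F | c ∈ C ∧ c t = 0} : Finset (ι → F)) (fun c => zc c)
    (a := 0) (by simp)
  rw [a2, z2, z0] at a2'
  have b1' := Finset.card_filter_add_card_filter_not (s := ({c : ι → F | c ∈ C} : Finset (ι → F)))
    (fun c => c t = 0)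
  have b2' := Finset.sum_filter_add_sum_filter_not ({c : ι → F | c ∈ C} : Finset (ι → F))
    (fun c => c t = 0) (fun c => zc c)
  rw [Finset.filter_filter, Finset.filter_filter] at b1' b2'
  rw [z1, t1, b1] at b1'
  rw [z2, t2, b2] at b2'
  have e : ∀ k, k ≠ 0 → ({c ∈ (({c : ι → F | c ∈ C ∧ c t = 0} : Finset (ι → F)).erase 0) |
      hammingNorm c = k}) = ({c : ι → F | c ∈ C ∧ c t = 0 ∧ hammingNorm c = k} : Finset _) := by
    intro k hk
    ext c
    simp only [mem_filter, mem_erase, mem_univ, true_and]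
    constructor
    · tauto
    · rintro ⟨x1, x2, x3⟩
      refine ⟨⟨?_, x1, x2⟩, x3⟩
      rintro rfl
      simp at x3; omega
  rw [e _ (by omega), e _ (by omega)] at a1 a2'
  rw [Finset.filter_filter, Finset.filter_filter] at b1' b2'
  simp only [and_assoc] at b1' b2'
  clear a2 b1 b2 e z0 t1 t2 z1 z2
  generalize #{c : ι → F | c ∈ C ∧ c t = 0 ∧ hammingNorm c = Fintype.card F ^ 2 - Fintype.card F}
    = N1 at *
  generalize #{c : ι → F | c ∈ C ∧ c t = 0 ∧ hammingNorm c = Fintype.card F ^ 2} = N2 at *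
  generalize #{c : ι → F | c ∈ C ∧ c t ≠ 0 ∧ hammingNorm c = Fintype.card F ^ 2 - Fintype.card F}
    = N3 at *
  generalize #{c : ι → F | c ∈ C ∧ c t ≠ 0 ∧ hammingNorm c = Fintype.card F ^ 2} = N4 at *
  generalize Fintype.card F = q at *
  have p3 : 1 ≤ q ^ 3 := Nat.one_le_pow _ _ (by omega)
  have p2 : 1 ≤ q ^ 2 := Nat.one_le_pow _ _ (by omega)
  have p1 : 1 ≤ q := by omega
  zify [p1, p2, p3] at *
  norm_num at b1' b2'
  have hq0 : (q : ℤ) ≠ 0 := by positivity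
  have r1 : (N1 : ℤ) = q * (q ^ 2 - 1) := by
    apply mul_left_cancel₀ hq0
    linear_combination a2' + a1
  have r3 : (N3 : ℤ) = q ^ 2 * (q - 1) ^ 2 := by
    apply mul_left_cancel₀ hq0
    linear_combination b2' - b1'
  refine ⟨r1, ?_, r3, ?_⟩
  · linear_combination - a1 - r1
  · linear_combination b1' - r3

lemma isMinDist_of (D : Submodule F (ι → F)) (d : ℕ) (hd : d ≠ 0) (h1 : weightCount D d ≠ 0)
    (h2 : ∀ k, k ≠ 0 → k < d → weightCount D k = 0) : IsMinDist D d := by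
  classical
  constructor
  · rw [weightCount_eq, Finset.card_ne_zero] at h1
    obtain ⟨c, hc⟩ := h1
    simp only [mem_filter, mem_univ, true_and] at hc
    refine ⟨c, hc.1, ?_, hc.2⟩
    rintro rfl
    simp at hc; omega
  · intro c hc hne
    by_contra! hlt
    have := h2 _ (hammingNorm_ne_zero_iff.2 hne) hlt
    rw [weightCount_eq, Finset.card_eq_zero, Finset.filter_eq_empty_iff] at this
    exact this (mem_univ c) ⟨hc, rfl⟩

lemma finrank_map_inj {κ : Type} (p : Submodule F (ι → F)) (f : (ι → F) →ₗ[F] (κ → F))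
    (h : ∀ x ∈ p, f x = 0 → x = 0) : Module.finrank F (p.map f) = Module.finrank F p := by
  rw [← LinearMap.range_domRestrict]
  apply LinearMap.finrank_range_of_inj
  rw [← LinearMap.ker_eq_bot, LinearMap.ker_eq_bot']
  rintro ⟨x, hx⟩ h0
  have := h x hx h0
  simpa using this

lemma Ov.hinj (h : Ov C) (t : ι) (c : ι → F) (hc : c ∈ C) (h0 : restrictTo {t} c = 0) : c = 0 := by
  by_contra hne
  have h1 := norm_restrict t c
  rw [h0, hammingNorm_zero] at h1
  have h2 := h.wts c hc hne
  have h4 := h.q2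
  have h5 := h.hq
  split_ifs at h1 <;> omega

lemma Ov.finrank_punct (h : Ov C) (t : ι) : Module.finrank F (puncturedCode C {t}) = 4 := by
  rw [← h.hd]
  exact finrank_map_inj _ _ (h.hinj t)

lemma Ov.finrank_short (h : Ov C) (t : ι) : Module.finrank F (shortenedCode C {t}) = 3 := by
  classical
  have : Module.finrank F (shortenedCode C {t}) = Module.finrank F ↥(C ⊓ zeroOn {t}) :=
    finrank_map_inj _ _ (fun x hx => h.hinj t x hx.1)
  rw [this]
  have e1 := code_card (C ⊓ zeroOn {t})
  have e2 := h.zero_card t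
  have e3 : #{c : ι → F | c ∈ C ⊓ zeroOn {t}} = #{c : ι → F | c ∈ C ∧ c t = 0} := by
    congr 1
    ext c
    simp [mem_zeroOn]
  rw [e3, e2] at e1
  exact (Nat.pow_right_injective (by have := h.hq; omega) e1).symm

lemma Ov.short_weights (h : Ov C) (t : ι) :
    weightCount (shortenedCode C {t}) 0 = 1 ∧
    weightCount (shortenedCode C {t}) (Fintype.card F ^ 2 - Fintype.card F)
      = Fintype.card F * (Fintype.card F ^ 2 - 1) ∧
    weightCount (shortenedCode C {t}) (Fintype.card F ^ 2) = Fintype.card F - 1 ∧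
    (∀ k : ℕ, k ≠ 0 → k ≠ Fintype.card F ^ 2 - Fintype.card F → k ≠ Fintype.card F ^ 2 →
      weightCount (shortenedCode C {t}) k = 0) := by
  classical
  obtain ⟨n1, n2, -, -⟩ := h.counts t
  simp only [weightCount_shortened]
  refine ⟨?_, n1, n2, ?_⟩
  · rw [Finset.card_eq_one]
    refine ⟨0, ?_⟩
    ext c
    simp only [mem_filter, mem_univ, true_and, hammingNorm_eq_zero, mem_singleton]
    constructor
    · tauto
    · rintro rfl; simp
  · intro k k0 k1 k2
    rw [Finset.card_eq_zero, Finset.filter_eq_empty_iff]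
    rintro c - ⟨hc, h0, hk⟩
    have hne : c ≠ 0 := by
      rintro rfl
      simp at hk; omega
    rcases h.wts c hc hne with h1 | h1 <;> omega

lemma Ov.punct_weights (h : Ov C) (t : ι) :
    weightCount (puncturedCode C {t}) 0 = 1 ∧
    weightCount (puncturedCode C {t}) (Fintype.card F ^ 2 - Fintype.card F - 1)
      = Fintype.card F ^ 2 * (Fintype.card F - 1) ^ 2 ∧
    weightCount (puncturedCode C {t}) (Fintype.card F ^ 2 - Fintype.card F)
      = Fintype.card F * (Fintype.card F ^ 2 - 1) ∧
    weightCount (puncturedCode C {t}) (Fintype.card F ^ 2 - 1)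
      = Fintype.card F ^ 2 * (Fintype.card F - 1) ∧
    weightCount (puncturedCode C {t}) (Fintype.card F ^ 2)
      = Fintype.card F - 1 ∧
    (∀ k : ℕ, k ≠ 0 → k ≠ Fintype.card F ^ 2 - Fintype.card F - 1 →
      k ≠ Fintype.card F ^ 2 - Fintype.card F → k ≠ Fintype.card F ^ 2 - 1 →
      k ≠ Fintype.card F ^ 2 →
      weightCount (puncturedCode C {t}) k = 0) := by
  classical
  obtain ⟨n1, n2, n3, n4⟩ := h.counts t
  have h4 := h.q2
  have h5 := h.hq
  simp only [weightCount_punctured C t (h.hinj t)]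
  have key : ∀ c ∈ C, (c = 0 ∧ c t = 0 ∧ hammingNorm c = 0 ∧ hammingNorm (restrictTo {t} c) = 0) ∨
      (c t = 0 ∧ hammingNorm c = Fintype.card F ^ 2 - Fintype.card F ∧
        hammingNorm (restrictTo {t} c) = Fintype.card F ^ 2 - Fintype.card F) ∨
      (c t = 0 ∧ hammingNorm c = Fintype.card F ^ 2 ∧
        hammingNorm (restrictTo {t} c) = Fintype.card F ^ 2) ∨
      (c t ≠ 0 ∧ hammingNorm c = Fintype.card F ^ 2 - Fintype.card F ∧
        hammingNorm (restrictTo {t} c) = Fintype.card F ^ 2 - Fintype.card F - 1) ∨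
      (c t ≠ 0 ∧ hammingNorm c = Fintype.card F ^ 2 ∧
        hammingNorm (restrictTo {t} c) = Fintype.card F ^ 2 - 1) := by
    intro c hc
    by_cases hne : c = 0
    · left; subst hne; simp
    · right
      have h1 := norm_restrict t c
      have h2 := h.wts c hc hne
      by_cases ht : c t = 0
      · rw [if_pos ht] at h1
        simp only [ht, ne_eq, not_true_eq_false, false_and, or_false, true_and]
        omega
      · rw [if_neg ht] at h1
        simp only [ht, ne_eq, not_false_eq_true, false_and, true_and, false_or]
        omega
  refine ⟨?_, ?_, ?_, ?_, ?_, ?_⟩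
  · rw [Finset.card_eq_one]
    refine ⟨0, ?_⟩
    ext c
    simp only [mem_filter, mem_univ, true_and, hammingNorm_eq_zero, mem_singleton]
    constructor
    · rintro ⟨x1, x2⟩; exact h.hinj t c x1 x2
    · rintro rfl; simp
  · rw [← n3]
    congr 1
    apply Finset.filter_congr
    intro c _
    refine and_congr_right fun hc => ?_
    rcases key c hc with ⟨-, k1, k2, k3⟩ | ⟨k1, k2, k3⟩ | ⟨k1, k2, k3⟩ | ⟨k1, k2, k3⟩ | ⟨k1, k2, k3⟩ <;>
      first
      | exact ⟨fun _ => ⟨k1, k2⟩, fun _ => k3⟩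
      | exact ⟨fun x => by omega, fun x => absurd x.1 k1⟩
      | exact ⟨fun x => by omega, fun x => absurd k1 x.1⟩
      | exact ⟨fun x => by omega, fun x => by have := x.2; omega⟩
  · rw [← n1]
    congr 1
    apply Finset.filter_congr
    intro c _
    refine and_congr_right fun hc => ?_
    rcases key c hc with ⟨-, k1, k2, k3⟩ | ⟨k1, k2, k3⟩ | ⟨k1, k2, k3⟩ | ⟨k1, k2, k3⟩ | ⟨k1, k2, k3⟩ <;>
      first
      | exact ⟨fun _ => ⟨k1, k2⟩, fun _ => k3⟩
      | exact ⟨fun x => by omega, fun x => absurd x.1 k1⟩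
      | exact ⟨fun x => by omega, fun x => absurd k1 x.1⟩
      | exact ⟨fun x => by omega, fun x => by have := x.2; omega⟩
  · rw [← n4]
    congr 1
    apply Finset.filter_congr
    intro c _
    refine and_congr_right fun hc => ?_
    rcases key c hc with ⟨-, k1, k2, k3⟩ | ⟨k1, k2, k3⟩ | ⟨k1, k2, k3⟩ | ⟨k1, k2, k3⟩ | ⟨k1, k2, k3⟩ <;>
      first
      | exact ⟨fun _ => ⟨k1, k2⟩, fun _ => k3⟩
      | exact ⟨fun x => by omega, fun x => absurd x.1 k1⟩
      | exact ⟨fun x => by omega, fun x => absurd k1 x.1⟩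
      | exact ⟨fun x => by omega, fun x => by have := x.2; omega⟩
  · rw [← n2]
    congr 1
    apply Finset.filter_congr
    intro c _
    refine and_congr_right fun hc => ?_
    rcases key c hc with ⟨-, k1, k2, k3⟩ | ⟨k1, k2, k3⟩ | ⟨k1, k2, k3⟩ | ⟨k1, k2, k3⟩ | ⟨k1, k2, k3⟩ <;>
      first
      | exact ⟨fun _ => ⟨k1, k2⟩, fun _ => k3⟩
      | exact ⟨fun x => by omega, fun x => absurd x.1 k1⟩
      | exact ⟨fun x => by omega, fun x => absurd k1 x.1⟩
      | exact ⟨fun x => by omega, fun x => by have := x.2; omega⟩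
  · intro k k0 k1 k2 k3 k4
    rw [Finset.card_eq_zero, Finset.filter_eq_empty_iff]
    rintro c - ⟨hc, hk⟩
    have := key c hc
    omega

lemma Ov.punct_indep (h : Ov C) (s t : ι) (k : ℕ) :
    weightCount (puncturedCode C {s}) k = weightCount (puncturedCode C {t}) k := by
  obtain ⟨a0, a1, a2, a3, a4, a5⟩ := h.punct_weights s
  obtain ⟨b0, b1, b2, b3, b4, b5⟩ := h.punct_weights t
  by_cases k0 : k = 0
  · rw [k0, a0, b0]
  by_cases k1 : k = Fintype.card F ^ 2 - Fintype.card F - 1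
  · rw [k1, a1, b1]
  by_cases k2 : k = Fintype.card F ^ 2 - Fintype.card F
  · rw [k2, a2, b2]
  by_cases k3 : k = Fintype.card F ^ 2 - 1
  · rw [k3, a3, b3]
  by_cases k4 : k = Fintype.card F ^ 2
  · rw [k4, a4, b4]
  rw [a5 k k0 k1 k2 k3 k4, b5 k k0 k1 k2 k3 k4]

lemma card_sub (t : ι) : Fintype.card {i : ι // i ∉ ({t} : Finset ι)} + 1 = Fintype.card ι := by
  have : 0 < Fintype.card ι := Fintype.card_pos_iff.2 ⟨t⟩
  rw [Fintype.card_subtype_compl]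
  simp
  omega

lemma Ov.design (h : Ov C) (t : ι) (k : ℕ) :
    (Fintype.card F ^ 2 + 1) * weightCount (shortenedCode (dualCode C) {t}) k =
      (Fintype.card F ^ 2 + 1 - k) * weightCount (dualCode C) k := by
  classical
  have h1 : ∀ s, weightCount (shortenedCode (dualCode C) {s}) k =
      weightCount (shortenedCode (dualCode C) {t}) k := by
    intro s
    rw [shortened_dual, shortened_dual]
    apply dual_weights_eq
    · have := card_sub s
      have := card_sub t
      omega
    · exact h.punct_indep s t
  have h2 : ∑ s : ι, weightCount (shortenedCode (dualCode C) {s}) k =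
      (Fintype.card F ^ 2 + 1) * weightCount (shortenedCode (dualCode C) {t}) k := by
    simp_rw [h1]
    rw [Finset.sum_const, Finset.card_univ, h.hn, smul_eq_mul]
  rw [← h2]
  have h3 := sum_zc ({c : ι → F | c ∈ dualCode C ∧ hammingNorm c = k} : Finset (ι → F))
  have h4 : ∀ s, weightCount (shortenedCode (dualCode C) {s}) k =
      #{c ∈ ({c : ι → F | c ∈ dualCode C ∧ hammingNorm c = k} : Finset (ι → F)) | c s = 0} := by
    intro s
    rw [weightCount_shortened, Finset.filter_filter]
    congr 1
    ext c
    simp only [mem_filter, mem_univ, true_and]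
    tauto
  simp_rw [h4]
  rw [← h3, weightCount_eq, Finset.sum_congr rfl (g := fun _ => Fintype.card F ^ 2 + 1 - k)]
  · rw [Finset.sum_const, smul_eq_mul, mul_comm]
  · intro c hc
    simp only [mem_filter, mem_univ, true_and] at hc
    have := zc_add c
    rw [h.hn, hc.2] at this
    omega

lemma Ov.dual4 (h : Ov C) (T : Finset ι) (hT : #T = 4) (c : ι → F) (hc : c ∈ C) (hne : c ≠ 0)
    (h0 : ∀ i ∈ T, c i = 0) :
    ∃ y ∈ dualCode C, hammingNorm y = 4 ∧ ∀ i, y i ≠ 0 ↔ i ∈ T := by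
  have e1 := rk C T
  have e2 : 0 < Module.finrank F ↥(C ⊓ zeroOn T) := by
    rw [Module.finrank_pos_iff]
    refine ⟨⟨⟨c, hc, h0⟩, 0, ?_⟩⟩
    intro hcon
    exact hne (congrArg Subtype.val hcon)
  rw [h.hd] at e1
  have e3 := finrank_dual_add (C.map (restr T))
  rw [Fintype.card_coe, hT] at e3
  have e4 : 0 < Module.finrank F (dualCode (C.map (restr T))) := by omega
  obtain ⟨⟨x, hx⟩, hx0⟩ := Module.finrank_pos_iff_exists_ne_zero.1 e4
  have hx0' : x ≠ 0 := fun hcon => hx0 (by simpa using hcon)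
  let y : ι → F := fun i => if hi : i ∈ T then x ⟨i, hi⟩ else 0
  have hy : y ∈ dualCode C := by
    intro d hd
    have := hx _ ⟨d, hd, rfl⟩
    rw [← this, ← Finset.sum_subset (Finset.subset_univ T)]
    · rw [← Finset.sum_coe_sort]
      apply Finset.sum_congr rfl
      rintro ⟨i, hi⟩ _
      simp only [y, dif_pos hi]
      rfl
    · intro i _ hi
      simp only [y, dif_neg hi, zero_mul]
  have hsub : ({i | y i ≠ 0} : Finset ι) ⊆ T := by
    intro i hi
    by_contra hiT
    simp [y, hiT] at hi
  have hyne : y ≠ 0 := by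
    obtain ⟨⟨i, hi⟩, hxi⟩ := Function.ne_iff.1 hx0'
    intro hcon
    have := congrFun hcon i
    simp only [y, dif_pos hi] at this
    exact hxi this
  have hge : ¬ hammingNorm y ≤ 3 := fun hle => hyne (h.dual y hy hle)
  have heq : ({i | y i ≠ 0} : Finset ι) = T := by
    apply Finset.eq_of_subset_of_card_le hsub
    unfold hammingNorm at hge
    omega
  refine ⟨y, hy, ?_, ?_⟩
  · unfold hammingNorm
    rw [heq, hT]
  · intro i
    rw [← heq]; simp

lemma Ov.exists_c (h : Ov C) (t : ι) : ∃ c ∈ C, c ≠ 0 ∧ c t = 0 ∧ zc c = Fintype.card F + 1 := by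
  classical
  have h4 := h.q2
  have h5 := h.hq
  have n1 := (h.counts t).1
  have : 0 < Fintype.card F * (Fintype.card F ^ 2 - 1) := Nat.mul_pos (by omega) (by omega)
  rw [← n1, Finset.card_pos] at this
  obtain ⟨c, hc⟩ := this
  simp only [mem_filter, mem_univ, true_and] at hc
  have hne : c ≠ 0 := by
    rintro rfl
    simp at hc
    omega
  refine ⟨c, hc.1, hne, hc.2.1, ?_⟩
  have := h.wts c hc.1 hne
  omega

lemma Ov.dual_short (h : Ov C) (t : ι) : IsMinDist (dualCode (shortenedCode C {t})) 3 := by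
  have e : dualCode (shortenedCode C {t}) = puncturedCode (dualCode C) {t} := by
    have := shortened_dual (dualCode C) t
    rw [dual_dual] at this
    rw [this, dual_dual]
  rw [e]
  constructor
  · obtain ⟨c, hc, hne, ht, hz⟩ := h.exists_c t
    have h5 := h.hq
    have hmem : t ∈ ({i | c i = 0} : Finset ι) := by simpa using ht
    obtain ⟨T, hT, hT3⟩ := Finset.exists_subset_card_eq (n := 3)
      (s := ({i | c i = 0} : Finset ι).erase t) (by
        rw [Finset.card_erase_of_mem hmem]
        unfold zc at hz
        omega)
    have htT : t ∉ T := fun hcon => by simpa using hT hcon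
    obtain ⟨y, hy, hy4, hyT⟩ := h.dual4 (insert t T) (by rw [Finset.card_insert_of_notMem htT, hT3])
      c hc hne (by
        intro i hi
        rcases Finset.mem_insert.1 hi with rfl | hi
        · exact ht
        · simpa using Finset.mem_of_mem_erase (hT hi))
    have h1 := norm_restrict t y
    rw [if_neg ((hyT t).2 (by simp)), hy4] at h1
    have h2 : hammingNorm (restrictTo {t} y) = 3 := by omega
    refine ⟨_, ⟨y, hy, rfl⟩, ?_, h2⟩
    intro hcon
    rw [hcon, hammingNorm_zero] at h2
    omega
  · rintro _ ⟨y, hy, rfl⟩ hne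
    have h1 := norm_restrict t y
    have h2 : ¬ hammingNorm y ≤ 3 := fun hle => hne (by rw [h.dual y hy hle, map_zero])
    split_ifs at h1 <;> omega

lemma Ov.short_dual (h : Ov C) (t : ι) : IsMinDist (shortenedCode (dualCode C) {t}) 4 := by
  constructor
  · obtain ⟨c, hc, hne, ht, hz⟩ := h.exists_c t
    have h5 := h.hq
    have hmem : t ∈ ({i | c i = 0} : Finset ι) := by simpa using ht
    obtain ⟨T, hT, hT3⟩ := Finset.exists_subset_card_eq (n := 4)
      (s := ({i | c i = 0} : Finset ι).erase t) (by
        rw [Finset.card_erase_of_mem hmem]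
        unfold zc at hz
        omega)
    have htT : t ∉ T := fun hcon => by simpa using hT hcon
    obtain ⟨y, hy, hy4, hyT⟩ := h.dual4 T hT3 c hc hne (by
        intro i hi
        simpa using Finset.mem_of_mem_erase (hT hi))
    have h1 := norm_restrict t y
    have hyt : y t = 0 := by
      by_contra hcon
      exact htT ((hyT t).1 hcon)
    rw [if_pos hyt, hy4] at h1
    have h2 : hammingNorm (restrictTo {t} y) = 4 := by omega
    refine ⟨_, ⟨y, ⟨hy, ?_⟩, rfl⟩, ?_, h2⟩
    · intro i hi
      rw [Finset.mem_singleton.1 hi, hyt]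
    · intro hcon
      rw [hcon, hammingNorm_zero] at h2
      omega
  · rintro _ ⟨y, ⟨hy, hy0⟩, rfl⟩ hne
    have h1 := norm_restrict t y
    rw [if_pos (hy0 t (by simp))] at h1
    have h2 : ¬ hammingNorm y ≤ 3 := fun hle => hne (by rw [h.dual y hy hle, map_zero])
    omega

end Final


/-- Shortened codes of an ovoid code `C` (a `[q²+1, 4, q²-q]` code over `GF(q)`, `q ≥ 4`)
and of its dual, together with their parameters and weight distributions. -/
theorem statement18 {F : Type} [Field F] [Fintype F] [DecidableEq F]
    (hq4 : 4 ≤ Fintype.card F)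
    (C : Submodule F (Fin (Fintype.card F ^ 2 + 1) → F))
    (hdim : Module.finrank F ↥C = 4)
    (hmd : IsMinDist C (Fintype.card F ^ 2 - Fintype.card F))
    (t1 : Fin (Fintype.card F ^ 2 + 1)) :
    -- (1) `C_{{t₁}}` is a `[q², 3, q²-q]` code with weight enumerator
    -- `1 + q(q²-1) z^{q²-q} + (q-1) z^{q²}`.
    Module.finrank F ↥(shortenedCode C {t1}) = 3 ∧
    IsMinDist (shortenedCode C {t1}) (Fintype.card F ^ 2 - Fintype.card F) ∧
    weightCount (shortenedCode C {t1}) 0 = 1 ∧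
    weightCount (shortenedCode C {t1}) (Fintype.card F ^ 2 - Fintype.card F)
      = Fintype.card F * (Fintype.card F ^ 2 - 1) ∧
    weightCount (shortenedCode C {t1}) (Fintype.card F ^ 2) = Fintype.card F - 1 ∧
    (∀ k : ℕ, k ≠ 0 → k ≠ Fintype.card F ^ 2 - Fintype.card F → k ≠ Fintype.card F ^ 2 →
      weightCount (shortenedCode C {t1}) k = 0) ∧
    -- (2) `(C_{{t₁}})^⊥` is a `[q², q²-3, 3]` code.
    Module.finrank F ↥(dualCode (shortenedCode C {t1})) = Fintype.card F ^ 2 - 3 ∧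
    IsMinDist (dualCode (shortenedCode C {t1})) 3 ∧
    -- (3) `((C^⊥)_{{t₁}})^⊥` is a `[q², 4, q²-q-1]` code with weight enumerator
    -- `1 + q²(q-1)² z^{q²-q-1} + q(q²-1) z^{q²-q} + q²(q-1) z^{q²-1} + (q-1) z^{q²}`.
    Module.finrank F ↥(dualCode (shortenedCode (dualCode C) {t1})) = 4 ∧
    IsMinDist (dualCode (shortenedCode (dualCode C) {t1}))
      (Fintype.card F ^ 2 - Fintype.card F - 1) ∧
    weightCount (dualCode (shortenedCode (dualCode C) {t1})) 0 = 1 ∧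
    weightCount (dualCode (shortenedCode (dualCode C) {t1}))
        (Fintype.card F ^ 2 - Fintype.card F - 1)
      = Fintype.card F ^ 2 * (Fintype.card F - 1) ^ 2 ∧
    weightCount (dualCode (shortenedCode (dualCode C) {t1}))
        (Fintype.card F ^ 2 - Fintype.card F)
      = Fintype.card F * (Fintype.card F ^ 2 - 1) ∧
    weightCount (dualCode (shortenedCode (dualCode C) {t1})) (Fintype.card F ^ 2 - 1)
      = Fintype.card F ^ 2 * (Fintype.card F - 1) ∧
    weightCount (dualCode (shortenedCode (dualCode C) {t1})) (Fintype.card F ^ 2)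
      = Fintype.card F - 1 ∧
    (∀ k : ℕ, k ≠ 0 → k ≠ Fintype.card F ^ 2 - Fintype.card F - 1 →
      k ≠ Fintype.card F ^ 2 - Fintype.card F → k ≠ Fintype.card F ^ 2 - 1 →
      k ≠ Fintype.card F ^ 2 →
      weightCount (dualCode (shortenedCode (dualCode C) {t1})) k = 0) ∧
    -- (4) `(C^⊥)_{{t₁}}` is a `[q², q²-4, 4]` code whose weight distribution satisfies
    -- `(q²+1)·C(q², k-1)·A_k((C^⊥)_{{t₁}}) = k·C(q², k)·A_k(C^⊥)` for `1 ≤ k ≤ q²`.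
    Module.finrank F ↥(shortenedCode (dualCode C) {t1}) = Fintype.card F ^ 2 - 4 ∧
    IsMinDist (shortenedCode (dualCode C) {t1}) 4 ∧
    ∀ k : ℕ, 1 ≤ k → k ≤ Fintype.card F ^ 2 →
      (Fintype.card F ^ 2 + 1) * Nat.choose (Fintype.card F ^ 2) (k - 1) *
          weightCount (shortenedCode (dualCode C) {t1}) k
        = k * Nat.choose (Fintype.card F ^ 2) k * weightCount (dualCode C) k := by

  have hqq : Fintype.card F ≤ Fintype.card F ^ 2 := Nat.le_self_pow (by norm_num) _
  have h : Ov C := by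
    refine ⟨hq4, by simp, hdim, ?_⟩
    intro c hc hne
    have h1 := hmd.2 c hc hne
    have h2 := zc_add c
    rw [Fintype.card_fin] at h2
    omega
  have h4 := h.q2
  have hcs := card_sub t1
  rw [Fintype.card_fin] at hcs
  have hpd : dualCode (shortenedCode (dualCode C) {t1}) = puncturedCode C {t1} := by
    rw [shortened_dual, dual_dual]
  obtain ⟨s0, s1, s2, s3⟩ := h.short_weights t1
  obtain ⟨p0, p1, p2, p3, p4, p5⟩ := h.punct_weights t1
  have f1 := h.finrank_short t1
  have f2 := h.finrank_punct t1
  have g1 := finrank_dual_add (shortenedCode C {t1})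
  have g2 := finrank_dual_add (puncturedCode C {t1})
  rw [hpd]
  refine ⟨f1, ?_, s0, s1, s2, s3, by omega, h.dual_short t1, f2, ?_, p0, p1, p2, p3, p4, p5, ?_,
    h.short_dual t1, ?_⟩
  · apply isMinDist_of _ _ (by omega)
    · rw [s1]
      exact (Nat.mul_pos (by omega) (by omega)).ne'
    · intro k k0 k1
      exact s3 k k0 (by omega) (by omega)
  · apply isMinDist_of _ _ (by omega)
    · rw [p1]
      exact (Nat.mul_pos (by omega) (Nat.pow_pos (by omega))).ne'
    · intro k k0 k1
      exact p5 k k0 (by omega) (by omega) (by omega) (by omega)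
  · rw [shortened_dual]
    omega
  · intro k hk1 hk2
    have hd := h.design t1 k
    obtain ⟨m, rfl⟩ : ∃ m, k = m + 1 := ⟨k - 1, by omega⟩
    have hch := Nat.choose_succ_right_eq (Fintype.card F ^ 2) m
    rw [Nat.add_sub_cancel]
    rw [Nat.add_sub_add_right] at hd
    calc _ = (Fintype.card F ^ 2).choose m *
          ((Fintype.card F ^ 2 + 1) * weightCount (shortenedCode (dualCode C) {t1}) (m + 1)) := by ring
      _ = ((Fintype.card F ^ 2).choose m * (Fintype.card F ^ 2 - m)) *
          weightCount (dualCode C) (m + 1) := by rw [hd]; ring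
      _ = _ := by rw [← hch]; ring
end
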